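/- arXiv:1303.4673 — 2 statements merged into one kernel-verified Lean document; each statement's English description precedes it below -/
import Mathlib

section
/- For every n ≠ 4, the achromatic index of the complete convex geometric graph on n vertices is at least floor((n^2+n)/4). -/
open scoped Classical

abbrev Pt : Type := ℝ × ℝ

/-- No three distinct points of `S` are collinear. -/
def GenPos (S : Finset Pt) : Prop :=
  ∀ p ∈ S, ∀ q ∈ S, ∀ r ∈ S, p ≠ q → q ≠ r → p ≠ r → ¬ Collinear ℝ ({p, q, r} : Set Pt)

/-- The closed straight-line segment of an (unordered) edge. -/
noncomputable def seg2 : Sym2 Pt → Set Pt :=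
  Sym2.lift ⟨fun p q => segment ℝ p q, fun p q => segment_symm ℝ p q⟩

/-- Two edges intersect: they share a point (common endpoint or crossing). -/
def SInter (e f : Sym2 Pt) : Prop := (seg2 e ∩ seg2 f).Nonempty

/-- A geometric graph: vertices in general position, straight-line edges. -/
structure GeomGraph where
  verts : Finset Pt
  edges : Finset (Sym2 Pt)
  genpos : GenPos verts
  edge_mem : ∀ e ∈ edges, ∀ p ∈ e, p ∈ verts
  edge_ne : ∀ e ∈ edges, ¬ e.IsDiag

/-- A coloring is complete on edge set `E` if every pair of used colors appears
on a pair of intersecting edges. -/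
def CompleteOn (E : Finset (Sym2 Pt)) (c : Sym2 Pt → ℕ) : Prop :=
  ∀ i ∈ E.image c, ∀ j ∈ E.image c, i ≠ j →
    ∃ e ∈ E, ∃ f ∈ E, c e = i ∧ c f = j ∧ SInter e f

/-- A coloring is proper if same-colored edges are disjoint. -/
def ProperOn (E : Finset (Sym2 Pt)) (c : Sym2 Pt → ℕ) : Prop :=
  ∀ e ∈ E, ∀ f ∈ E, e ≠ f → c e = c f → ¬ SInter e f

/-- Points in convex position. -/
def ConvexPos (S : Finset Pt) : Prop :=
  ∀ p ∈ S, p ∉ convexHull ℝ ((S : Set Pt) \ {p})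

/-- Edge set of the complete geometric graph on `S`. -/
noncomputable def edgeSet (S : Finset Pt) : Finset (Sym2 Pt) :=
  S.sym2.filter (fun e => ¬ e.IsDiag)

def ShareEndpoint (e f : Sym2 Pt) : Prop := ∃ p : Pt, p ∈ e ∧ p ∈ f

def Crossing (e f : Sym2 Pt) : Prop := SInter e f ∧ ¬ ShareEndpoint e f

/-- Number of unordered pairs of distinct edges of `E` satisfying the
(symmetric) relation `P`. -/
noncomputable def pairCount (E : Finset (Sym2 Pt)) (P : Sym2 Pt → Sym2 Pt → Prop) : ℕ :=
  ((E ×ˢ E).filter (fun q => q.1 ≠ q.2 ∧ P q.1 q.2)).card / 2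

/-- The `k`-th vertex (clockwise) of the regular `n`-gon. -/
noncomputable def pt (n k : ℕ) : Pt :=
  (Real.cos (2 * Real.pi * k / n), -Real.sin (2 * Real.pi * k / n))

/-- Vertex set of the regular `n`-gon. -/
noncomputable def ngon (n : ℕ) : Finset Pt := (Finset.range n).image (pt n)

/-- `pq` is a halving edge of `S`: each open half-plane bounded by the line
through `p` and `q` contains at least `⌊(n-2)/2⌋` points of `S`. -/
def IsHalvingPts (S : Finset Pt) (p q : Pt) : Prop :=
  (S.card - 2) / 2 ≤ (S.filter (fun r =>
      0 < (q.1 - p.1) * (r.2 - p.2) - (q.2 - p.2) * (r.1 - p.1))).card ∧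
  (S.card - 2) / 2 ≤ (S.filter (fun r =>
      (q.1 - p.1) * (r.2 - p.2) - (q.2 - p.2) * (r.1 - p.1) < 0)).card

/-- The edge `e_{i,j}` of the regular `n`-gon is halving. -/
def Halving (n i j : ℕ) : Prop := IsHalvingPts (ngon n) (pt n i) (pt n j)

/-- The edges `e_{i,j}` and `e_{i',j'}` of the regular `n`-gon intersect. -/
def EInter (n i j i' j' : ℕ) : Prop :=
  (segment ℝ (pt n i) (pt n j) ∩ segment ℝ (pt n i') (pt n j')).Nonempty

/-- `(e_{i,j}, e_{j+1,k})` is a halving pair. -/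
def HalvingPair (n i j k : ℕ) : Prop :=
  pt n i ≠ pt n j ∧ pt n (j + 1) ≠ pt n k ∧ ¬ EInter n i j (j + 1) k ∧
  (Halving n i (j + 1) ∨ Halving n i k ∨ Halving n j k)

/-- Two chords `{a, b}` and `{c, d}` with `a < b` and `c < d` of a convex polygon whose vertices
are numbered consecutively are disjoint. -/
def ChordDisj (e f : ℕ × ℕ) : Prop :=
  e.2 < f.1 ∨ f.2 < e.1 ∨ (e.1 < f.1 ∧ f.2 < e.2) ∨ (f.1 < e.1 ∧ e.2 < f.2)

/-- `x` and `y` are consecutive vertices of an `n`-gon. -/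
def Consec (n x y : ℕ) : Prop :=
  y = x + 1 ∨ x = y + 1 ∨ (x = 0 ∧ y + 1 = n) ∨ (y = 0 ∧ x + 1 = n)

/-- A family of `n` pairwise intersecting chords of an `n`-gon, where `m = n / 2`. -/
def Thrackle (m : ℕ) (extra : ℕ × ℕ) (x y : ℕ) : Prop :=
  y = x + m ∨ y = x + (m + 1) ∨ (x = extra.1 ∧ y = extra.2)

/-- The chords `(a, b)` and `(c, d)` have consecutive endpoints, and some chord of `H` has its
endpoints among `a`, `b`, `c`, `d`. -/
def Linked (n : ℕ) (H : ℕ → ℕ → Prop) (a b c d : ℕ) : Prop :=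
  (Consec n a c ∨ Consec n a d ∨ Consec n b c ∨ Consec n b d) ∧
  ((a < c ∧ H a c) ∨ (c < a ∧ H c a) ∨ (a < d ∧ H a d) ∨ (d < a ∧ H d a) ∨
    (b < c ∧ H b c) ∨ (c < b ∧ H c b) ∨ (b < d ∧ H b d) ∨ (d < b ∧ H d b))

/-- The involution on chords of a `(2m+1)`-gon that matches a chord spanning an even number
`e < k` of sides with the chord spanning the next `k - e` sides after a gap of one side. -/
def matchBase (m k a b : ℕ) : ℕ × ℕ :=
  if b - a ≤ m then
    if (b - a) % 2 = 0 then
      if a + k + 1 ≤ 2 * m then (b + 1, a + k + 1)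
      else if b < 2 * m then (a + k - 2 * m, b + 1)
      else (0, a + k - 2 * m)
    else if k + 1 ≤ b then (b - k - 1, a - 1)
    else if 1 ≤ a then (a - 1, b + 2 * m - k)
    else (b + 2 * m - k, 2 * m)
  else if (2 * m + 1 - (b - a)) % 2 = 0 then (a + 1, b + k - 2 * m)
  else (a + 2 * m - k, b - 1)

/-- The matching of the chords of a `(2m+1)`-gon for odd `m`. -/
def matchThree (m a b : ℕ) : ℕ × ℕ :=
  if b = a + m then (a, b)
  else if b = a + (m + 1) then (a, b)
  else matchBase m m a b

/-- The matching of the chords of a `(2m+1)`-gon for even `m`. -/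
def matchOne (m a b : ℕ) : ℕ × ℕ :=
  if b = a + m then
    if a = m then (0, m - 1) else (a, b)
  else if b = a + (m + 1) then (a, b)
  else if b = a + (m + 2) then (a + 2, b - 1)
  else if b + 1 = a + m then
    if a = 0 then (m, 2 * m)
    else if a = 1 then (m + 1, 2 * m)
    else if a = m + 1 then (1, m)
    else (a - 2, b + 1)
  else matchBase m (m - 1) a b

/-- `s` matches the chord `(a, b)` of an `n`-gon with itself if it lies in `H`, or with a disjoint
chord linked to it. -/
def MatchSpec (n : ℕ) (H : ℕ → ℕ → Prop) (s : ℕ → ℕ → ℕ × ℕ) (a b : ℕ) : Prop :=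
  (s a b).1 < (s a b).2 ∧ (s a b).2 < n ∧ s (s a b).1 (s a b).2 = (a, b) ∧
    (s a b = (a, b) ∧ H a b ∨
      ChordDisj (a, b) (s a b) ∧ Linked n H a b (s a b).1 (s a b).2)

/-- The pairs of chords `(a, b)` and `(c, d)`, the first one spanning an even number of sides, that
`matchBase` matches. -/
def BaseRel (m k a b c d : ℕ) : Prop :=
  (b < a + k ∧ (b - a) % 2 = 0 ∧ c = b + 1 ∧ d = a + k + 1) ∨
  (b < a + k ∧ (b - a) % 2 = 0 ∧ c + 2 * m = a + k ∧ d = b + 1) ∨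
  (b = 2 * m ∧ b < a + k ∧ (b - a) % 2 = 0 ∧ c = 0 ∧ d + 2 * m = a + k) ∨
  (a + 2 * m + 1 < b + k ∧ (b - a) % 2 = 1 ∧ c = a + 1 ∧ d + 2 * m = b + k)

theorem ChordDisj.symm {e f : ℕ × ℕ} (h : ChordDisj e f) : ChordDisj f e := by
  unfold ChordDisj at *
  omega

theorem Consec.symm {n x y : ℕ} (h : Consec n x y) : Consec n y x := by
  unfold Consec at *
  omega

theorem Linked.symm {n : ℕ} {H : ℕ → ℕ → Prop} {a b c d : ℕ} (h : Linked n H a b c d) :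
    Linked n H c d a b := by
  obtain ⟨h1, h2⟩ := h
  constructor
  · rcases h1 with h1 | h1 | h1 | h1
    · exact .inl h1.symm
    · exact .inr (.inr (.inl h1.symm))
    · exact .inr (.inl h1.symm)
    · exact .inr (.inr (.inr h1.symm))
  · rcases h2 with h2 | h2 | h2 | h2 | h2 | h2 | h2 | h2 <;> simp only [h2, and_self, true_or, or_true]

theorem BaseRel.linked {n m k a b c d : ℕ} (extra : ℕ × ℕ) (h : BaseRel m k a b c d) (hk : k ≤ m)
    (hk1 : k % 2 = 1) (hm : m ≤ k + 1) (hab : a < b) (hb : b < n) (hcd : c < d) (hd : d < n)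
    (hn : n = 2 * m ∨ n = 2 * m + 1) :
    ChordDisj (a, b) (c, d) ∧ Linked n (Thrackle m extra) a b c d := by
  unfold BaseRel at h
  unfold ChordDisj Linked Consec Thrackle
  rcases h with h | h | h | h
  · exact ⟨.inl (by omega), .inr (.inr (.inl (by omega))),
      .inr (.inr (.inl (by omega)))⟩
  · exact ⟨.inr (.inr (.inr (by omega))), .inr (.inr (.inr (by omega))),
      .inr (.inl (by omega))⟩
  · exact ⟨.inr (.inl (by omega)), .inr (.inr (.inl (by omega))),
      .inr (.inr (.inr (.inl (by omega))))⟩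
  · exact ⟨.inr (.inr (.inl (by omega))), .inl (by omega),
      .inr (.inr (.inr (.inr (.inr (.inr (.inr (by omega)))))))⟩

set_option maxHeartbeats 1000000 in
theorem BaseRel.matchBase_eq {m k a b c d : ℕ} (h : BaseRel m k a b c d) (hk : k ≤ m)
    (hk1 : k % 2 = 1) (hab : a < b) (hb : b ≤ 2 * m) (hcd : c < d) (hd : d ≤ 2 * m) :
    matchBase m k a b = (c, d) ∧ matchBase m k c d = (a, b) := by
  unfold BaseRel at h
  unfold matchBase
  constructor
  all_goals
    rcases h with h | h | h | h
    all_goals split_ifs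
    all_goals
      refine Prod.ext ?_ ?_
      all_goals
        dsimp only
        omega

theorem baseRel_of_matchBase_eq {m k a b c d : ℕ} (h : matchBase m k a b = (c, d)) (hk : k ≤ m)
    (hk1 : k % 2 = 1) (hm : m ≤ k + 1) (hab : a < b) (hb : b ≤ 2 * m)
    (hl : b < a + k ∨ a + 2 * m + 1 < b + k) :
    c < d ∧ d ≤ 2 * m ∧ (BaseRel m k a b c d ∨ BaseRel m k c d a b) := by
  unfold matchBase at h
  split_ifs at h
  all_goals
    rw [Prod.mk.injEq] at h
    obtain ⟨hc, hd⟩ := h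
    refine ⟨by omega, by omega, ?_⟩
    unfold BaseRel
    first
    | exact .inl (.inl (by omega))
    | exact .inl (.inr (.inl (by omega)))
    | exact .inl (.inr (.inr (.inl (by omega))))
    | exact .inl (.inr (.inr (.inr (by omega))))
    | exact .inr (.inl (by omega))
    | exact .inr (.inr (.inl (by omega)))
    | exact .inr (.inr (.inr (.inl (by omega))))
    | exact .inr (.inr (.inr (.inr (by omega))))

theorem linked_of_matchBase_eq {n m k a b c d : ℕ} {extra : ℕ × ℕ} (h : matchBase m k a b = (c, d))
    (hk : k ≤ m) (hk1 : k % 2 = 1) (hm : m ≤ k + 1) (hab : a < b) (hb : b < n) (hd : d < n)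
    (hn : n = 2 * m ∨ n = 2 * m + 1) (hl : b < a + k ∨ a + 2 * m + 1 < b + k) :
    ChordDisj (a, b) (c, d) ∧ Linked n (Thrackle m extra) a b c d := by
  obtain ⟨hcd, hd', hr⟩ := baseRel_of_matchBase_eq h hk hk1 hm hab (by omega) hl
  rcases hr with hr | hr
  · exact hr.linked extra hk hk1 hm hab hb hcd hd hn
  · obtain ⟨h1, h2⟩ := hr.linked extra hk hk1 hm hcd hd hab hb hn
    exact ⟨h1.symm, h2.symm⟩

set_option maxHeartbeats 2000000 in
theorem matchSpec_matchThree (m a b : ℕ) (hm : m % 2 = 1) (hab : a < b) (hb : b < 2 * m + 1) :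
    MatchSpec (2 * m + 1) (Thrackle m (0, m)) (matchThree m) a b := by
  unfold MatchSpec
  generalize hs : matchThree m a b = p
  obtain ⟨c, d⟩ := p
  dsimp only
  have h_main : c < d ∧ d < 2 * m + 1 ∧ matchThree m c d = (a, b) := by
    unfold matchThree at hs
    split_ifs at hs
    all_goals first
    | obtain ⟨hcd, hd, hr⟩ := baseRel_of_matchBase_eq hs (by omega) (by omega) (by omega) hab
        (by omega) (by omega)
      have h_inv : matchBase m m c d = (a, b) := by
        rcases hr with hr | hr
        · exact (hr.matchBase_eq (by omega) (by omega) hab (by omega) hcd hd).2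
        · exact (hr.matchBase_eq (by omega) (by omega) hcd hd hab (by omega)).1
      rw [← h_inv]
      unfold BaseRel at hr
      rcases hr with (hr | hr | hr | hr) | (hr | hr | hr | hr)
      all_goals
        refine ⟨hcd, by omega, ?_⟩
        unfold matchThree
        split_ifs
        all_goals first
        | rfl
        | (exfalso; omega)
    | rw [Prod.mk.injEq] at hs
      obtain ⟨hc, hd⟩ := hs
      refine ⟨by omega, by omega, ?_⟩
      unfold matchThree
      split_ifs
      all_goals
        refine Prod.ext ?_ ?_
        all_goals
          dsimp only
          omega
  obtain ⟨hcd, hd, h_inv⟩ := h_main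
  refine ⟨hcd, hd, h_inv, ?_⟩
  clear h_inv
  unfold matchThree at hs
  split_ifs at hs
  all_goals first
  | exact .inr (linked_of_matchBase_eq hs (by omega) (by omega) (by omega) hab (by omega) (by omega)
      (by omega) (by omega))
  | rw [Prod.mk.injEq] at hs
    obtain ⟨hc, hd⟩ := hs
    unfold Thrackle
    exact .inl ⟨by rw [hc, hd], by omega⟩

set_option maxHeartbeats 2000000 in
theorem matchSpec_matchOne (m a b : ℕ) (hm : m % 2 = 0) (hab : a < b) (hb : b < 2 * m + 1) :
    MatchSpec (2 * m + 1) (Thrackle m (0, m)) (matchOne m) a b := by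
  unfold MatchSpec
  generalize hs : matchOne m a b = p
  obtain ⟨c, d⟩ := p
  dsimp only
  have h_main : c < d ∧ d < 2 * m + 1 ∧ matchOne m c d = (a, b) := by
    unfold matchOne at hs
    split_ifs at hs
    all_goals first
    | obtain ⟨hcd, hd, hr⟩ := baseRel_of_matchBase_eq hs (by omega) (by omega) (by omega) hab
        (by omega) (by omega)
      have h_inv : matchBase m (m - 1) c d = (a, b) := by
        rcases hr with hr | hr
        · exact (hr.matchBase_eq (by omega) (by omega) hab (by omega) hcd hd).2
        · exact (hr.matchBase_eq (by omega) (by omega) hcd hd hab (by omega)).1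
      rw [← h_inv]
      unfold BaseRel at hr
      rcases hr with (hr | hr | hr | hr) | (hr | hr | hr | hr)
      all_goals
        refine ⟨hcd, by omega, ?_⟩
        unfold matchOne
        split_ifs
        all_goals first
        | rfl
        | (exfalso; omega)
    | rw [Prod.mk.injEq] at hs
      obtain ⟨hc, hd⟩ := hs
      refine ⟨by omega, by omega, ?_⟩
      unfold matchOne
      split_ifs
      all_goals
        refine Prod.ext ?_ ?_
        all_goals
          dsimp only
          omega
  obtain ⟨hcd, hd, h_inv⟩ := h_main
  refine ⟨hcd, hd, h_inv, ?_⟩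
  clear h_inv
  unfold matchOne at hs
  split_ifs at hs
  all_goals first
  | exact .inr (linked_of_matchBase_eq hs (by omega) (by omega) (by omega) hab (by omega) (by omega)
      (by omega) (by omega))
  | rw [Prod.mk.injEq] at hs
    obtain ⟨hc, hd⟩ := hs
    unfold Linked ChordDisj Consec Thrackle
    dsimp only
    first
    | exact .inl ⟨by rw [hc, hd], by omega⟩
    | refine .inr ⟨?_, ?_, ?_⟩
      · first
        | exact .inl (by omega)
        | exact .inr (.inl (by omega))
        | exact .inr (.inr (.inl (by omega)))
        | exact .inr (.inr (.inr (by omega)))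
      · first
        | exact .inl (by omega)
        | exact .inr (.inl (by omega))
        | exact .inr (.inr (.inl (by omega)))
        | exact .inr (.inr (.inr (by omega)))
      · first
        | exact .inl (by omega)
        | exact .inr (.inl (by omega))
        | exact .inr (.inr (.inl (by omega)))

/-- The matching of the chords of a `2m`-gon that agrees with `matchBase` on the chords whose
partner avoids the vertex `2m`, and is otherwise given by `t` on the chords spanning fewer than `k`
sides and by `u` on the remaining ones. -/
def matchEven (m k : ℕ) (t u : ℕ → ℕ → ℕ × ℕ) (a b : ℕ) : ℕ × ℕ :=
  if b < a + k ∨ a + 2 * m + 1 < b + k then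
    if (matchBase m k a b).2 = 2 * m then t a b else matchBase m k a b
  else u a b

/-- The chords of the `2m`-gon that `matchBase` matches with a chord ending in `2m`. -/
def Orphan (m k a b : ℕ) : Prop :=
  (a + k + 1 = 2 * m ∧ (b - a) % 2 = 0 ∧ b < a + k) ∨
  (b + 1 = 2 * m ∧ (b - a) % 2 = 0 ∧ b < a + k) ∨
  (a = 0 ∧ b % 2 = 1 ∧ b < k) ∨ (b = k ∧ a % 2 = 0 ∧ 0 < a)

theorem matchBase_snd_of_orphan {m k a b : ℕ} (h : Orphan m k a b) (hk : k ≤ m) (hk1 : k % 2 = 1)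
    (hm : m ≤ k + 1) (hab : a < b) (hb : b < 2 * m) : (matchBase m k a b).2 = 2 * m := by
  unfold matchBase
  rcases h with h | h | h | h <;> split_ifs <;> dsimp only <;> omega

theorem orphan_of_matchBase_snd {m k a b : ℕ} (h : (matchBase m k a b).2 = 2 * m) (hk : k ≤ m)
    (hk1 : k % 2 = 1) (hm : m ≤ k + 1) (hab : a < b) (hb : b < 2 * m)
    (hl : b < a + k ∨ a + 2 * m + 1 < b + k) : Orphan m k a b := by
  rcases hp : matchBase m k a b with ⟨c, d⟩
  rw [hp] at h
  dsimp only at h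
  obtain ⟨hcd, hd, hr⟩ := baseRel_of_matchBase_eq hp hk hk1 hm hab hb.le hl
  unfold BaseRel at hr
  unfold Orphan
  rcases hr with (hr | hr | hr | hr) | (hr | hr | hr | hr)
  · exact .inl (by omega)
  · exact .inr (.inl (by omega))
  · omega
  · omega
  · omega
  · omega
  · exact .inr (.inr (.inl (by omega)))
  · exact .inr (.inr (.inr (by omega)))

theorem matchEven_of_orphan {m k a b : ℕ} (t u : ℕ → ℕ → ℕ × ℕ) (h : Orphan m k a b) (hk : k ≤ m)
    (hk1 : k % 2 = 1) (hm : m ≤ k + 1) (hab : a < b) (hb : b < 2 * m) :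
    matchEven m k t u a b = t a b := by
  have hl : b < a + k ∨ a + 2 * m + 1 < b + k := by
    rcases h with h | h | h | h <;> omega
  rw [matchEven, if_pos hl, if_pos (matchBase_snd_of_orphan h hk hk1 hm hab hb)]

theorem matchEven_of_le {m k a b : ℕ} (t u : ℕ → ℕ → ℕ × ℕ) (h : a + k ≤ b)
    (h' : b + k ≤ a + 2 * m + 1) : matchEven m k t u a b = u a b := by
  rw [matchEven, if_neg (by omega)]

theorem matchSpec_matchEven {m k a b : ℕ} {extra : ℕ × ℕ} {t u : ℕ → ℕ → ℕ × ℕ} (hk : k ≤ m)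
    (hk1 : k % 2 = 1) (hm : m ≤ k + 1) (hab : a < b) (hb : b < 2 * m)
    (ht : Orphan m k a b → MatchSpec (2 * m) (Thrackle m extra) (matchEven m k t u) a b)
    (hu : a + k ≤ b → b + k ≤ a + 2 * m + 1 →
      MatchSpec (2 * m) (Thrackle m extra) (matchEven m k t u) a b) :
    MatchSpec (2 * m) (Thrackle m extra) (matchEven m k t u) a b := by
  by_cases hl : b < a + k ∨ a + 2 * m + 1 < b + k
  swap
  · exact hu (by omega) (by omega)
  by_cases hp : (matchBase m k a b).2 = 2 * m
  · exact ht (orphan_of_matchBase_snd hp hk hk1 hm hab hb hl)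
  have he : matchEven m k t u a b = matchBase m k a b := by
    rw [matchEven, if_pos hl, if_neg hp]
  unfold MatchSpec
  rw [he]
  rcases hs : matchBase m k a b with ⟨c, d⟩
  rw [hs] at hp
  dsimp only at hp ⊢
  obtain ⟨hcd, hd, hr⟩ := baseRel_of_matchBase_eq hs hk hk1 hm hab hb.le hl
  have hd' : d < 2 * m := by omega
  have h_inv : matchBase m k c d = (a, b) := by
    rcases hr with hr | hr
    · exact (hr.matchBase_eq hk hk1 hab hb.le hcd hd).2
    · exact (hr.matchBase_eq hk hk1 hcd hd hab hb.le).1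
  have hl' : d < c + k ∨ c + 2 * m + 1 < d + k := by
    unfold BaseRel at hr
    rcases hr with (hr | hr | hr | hr) | (hr | hr | hr | hr) <;> omega
  refine ⟨hcd, hd', ?_, .inr (linked_of_matchBase_eq hs hk hk1 hm hab hb hd' (.inl rfl) hl)⟩
  rw [matchEven, if_pos hl', h_inv, if_neg (by dsimp only; omega)]

theorem MatchSpec.of_eq {n : ℕ} {H : ℕ → ℕ → Prop} {s : ℕ → ℕ → ℕ × ℕ} {a b c d : ℕ}
    (h : s a b = (c, d)) (h' : s c d = (a, b)) (hcd : c < d) (hd : d < n)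
    (hdisj : ChordDisj (a, b) (c, d)) (hl : Linked n H a b c d) : MatchSpec n H s a b := by
  unfold MatchSpec
  rw [h]
  exact ⟨hcd, hd, h', .inr ⟨hdisj, hl⟩⟩

theorem MatchSpec.of_fixed {n : ℕ} {H : ℕ → ℕ → Prop} {s : ℕ → ℕ → ℕ × ℕ} {a b : ℕ}
    (h : s a b = (a, b)) (hab : a < b) (hb : b < n) (hH : H a b) : MatchSpec n H s a b := by
  unfold MatchSpec
  rw [h]
  exact ⟨hab, hb, h, .inl ⟨rfl, hH⟩⟩

/-- The values of `matchTwo` on orphans. -/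
def orphanTwo (m a b : ℕ) : ℕ × ℕ :=
  if b = m then (0, a - 1)
  else if a = 0 then (b + 1, m)
  else if a = m then (a, b)
  else if a + 1 = m then
    if b + 2 = 2 * m then (m - 2, 2 * m - 1) else (b + 1, 2 * m - 1)
  else (m - 1, a - 1)

/-- The values of `matchTwo` on the longest chords. -/
def longTwo (m a b : ℕ) : ℕ × ℕ :=
  if a + 2 = m ∧ b + 1 = 2 * m then (m - 1, 2 * m - 2) else (a, b)

/-- The matching of the chords of a `2m`-gon for odd `m`. -/
def matchTwo (m : ℕ) : ℕ → ℕ → ℕ × ℕ :=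
  matchEven m m (orphanTwo m) (longTwo m)

/-- The values of `matchZero` on orphans. -/
def orphanZero (m a b : ℕ) : ℕ × ℕ :=
  if a = 0 then
    if b = 1 then (m, 2 * m - 1) else (b + m, 2 * m - 1)
  else if b + 1 = m then (m, m + a)
  else if a = m then (b - m, m - 1)
  else if a = m + 1 then (1, m)
  else (0, a - m)

/-- The values of `matchZero` on the longest chords. -/
def longZero (m a b : ℕ) : ℕ × ℕ :=
  if b = a + (m + 2) then (a + 2, b - 1)
  else if b + 1 = a + m then
    if a = 0 then (a, b)
    else if a = 1 then (m + 1, 2 * m - 1)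
    else if a = m then (0, 1)
    else (a - 2, b + 1)
  else (a, b)

/-- The matching of the chords of a `2m`-gon for even `m`. -/
def matchZero (m : ℕ) : ℕ → ℕ → ℕ × ℕ :=
  matchEven m (m - 1) (orphanZero m) (longZero m)

theorem matchTwo_of_orphan {m a b : ℕ} (hm : m % 2 = 1) (h : Orphan m m a b) (hab : a < b)
    (hb : b < 2 * m) : matchTwo m a b = orphanTwo m a b :=
  matchEven_of_orphan _ _ h (by omega) (by omega) (by omega) hab hb

theorem matchTwo_of_le {m a b : ℕ} (h : a + m ≤ b) (h' : b + m ≤ a + 2 * m + 1) :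
    matchTwo m a b = longTwo m a b :=
  matchEven_of_le _ _ h h'

set_option maxHeartbeats 2000000 in
theorem matchSpec_matchTwo (m a b : ℕ) (hm : m % 2 = 1) (hab : a < b) (hb : b < 2 * m) :
    MatchSpec (2 * m) (Thrackle m (m, 2 * m - 1)) (matchTwo m) a b := by
  refine matchSpec_matchEven (by omega) (by omega) (by omega) hab hb (fun ho => ?_)
    (fun h1 h2 => ?_)
  all_goals change MatchSpec _ _ (matchTwo m) a b
  all_goals rcases hs : matchTwo m a b with ⟨c, d⟩
  all_goals have h_eq := hs
  · rw [matchTwo_of_orphan (by omega) ho hab hb, orphanTwo] at hs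
    unfold Orphan at ho
    split_ifs at hs
    all_goals
      rw [Prod.mk.injEq] at hs
      obtain ⟨hc, hd⟩ := hs
      have hh : c < d ∧ d < 2 * m := by rcases ho with h | h | h | h <;> omega
      first
      | exact .of_fixed (h_eq.trans (by rw [hc, hd])) hab hb (by unfold Thrackle; omega)
      | refine .of_eq h_eq ?_ hh.1 hh.2 ?_ ?_
        · first
          | rw [matchTwo_of_orphan (by omega) (by unfold Orphan; omega) hh.1 hh.2, orphanTwo]
          | rw [matchTwo_of_le (by omega) (by omega), longTwo]
          split_ifs
          all_goals
            refine Prod.ext ?_ ?_ <;> dsimp only <;> omega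
        · unfold ChordDisj
          dsimp only
          omega
        · unfold Linked Consec Thrackle
          constructor
          · first
            | exact .inl (by omega)
            | exact .inr (.inl (by omega))
            | exact .inr (.inr (.inl (by omega)))
          · first
            | exact .inl (by omega)
            | exact .inr (.inl (by omega))
            | exact .inr (.inr (.inl (by omega)))
            | exact .inr (.inr (.inr (.inl (by omega))))
            | exact .inr (.inr (.inr (.inr (.inl (by omega)))))
            | exact .inr (.inr (.inr (.inr (.inr (.inl (by omega))))))
  · rw [matchTwo_of_le h1 h2, longTwo] at hs
    split_ifs at hs
    all_goals
      rw [Prod.mk.injEq] at hs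
      obtain ⟨hc, hd⟩ := hs
      have hh : c < d ∧ d < 2 * m := by omega
      first
      | exact .of_fixed (h_eq.trans (by rw [hc, hd])) hab hb (by unfold Thrackle; omega)
      | refine .of_eq h_eq ?_ hh.1 hh.2 ?_ ?_
        · rw [matchTwo_of_orphan (by omega) (by unfold Orphan; omega) hh.1 hh.2, orphanTwo]
          split_ifs
          all_goals
            refine Prod.ext ?_ ?_ <;> dsimp only <;> omega
        · unfold ChordDisj
          dsimp only
          omega
        · unfold Linked Consec Thrackle
          constructor
          · exact .inl (by omega)
          · first
            | exact .inl (by omega)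
            | exact .inr (.inl (by omega))
            | exact .inr (.inr (.inl (by omega)))

theorem matchZero_of_orphan {m a b : ℕ} (hm : m % 2 = 0 ∧ 4 ≤ m) (h : Orphan m (m - 1) a b)
    (hab : a < b) (hb : b < 2 * m) : matchZero m a b = orphanZero m a b :=
  matchEven_of_orphan _ _ h (by omega) (by omega) (by omega) hab hb

theorem matchZero_of_le {m a b : ℕ} (h : a + (m - 1) ≤ b) (h' : b + (m - 1) ≤ a + 2 * m + 1) :
    matchZero m a b = longZero m a b :=
  matchEven_of_le _ _ h h'

set_option maxHeartbeats 2000000 in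
theorem matchSpec_matchZero (m a b : ℕ) (hm : m % 2 = 0 ∧ 4 ≤ m) (hab : a < b) (hb : b < 2 * m) :
    MatchSpec (2 * m) (Thrackle m (0, m - 1)) (matchZero m) a b := by
  refine matchSpec_matchEven (by omega) (by omega) (by omega) hab hb (fun ho => ?_)
    (fun h1 h2 => ?_)
  all_goals change MatchSpec _ _ (matchZero m) a b
  all_goals rcases hs : matchZero m a b with ⟨c, d⟩
  all_goals have h_eq := hs
  · rw [matchZero_of_orphan (by omega) ho hab hb, orphanZero] at hs
    unfold Orphan at ho
    split_ifs at hs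
    all_goals
      rw [Prod.mk.injEq] at hs
      obtain ⟨hc, hd⟩ := hs
      have hh : c < d ∧ d < 2 * m := by rcases ho with h | h | h | h <;> omega
      refine .of_eq h_eq ?_ hh.1 hh.2 ?_ ?_
      · first
        | rw [matchZero_of_orphan (by omega) (by unfold Orphan; omega) hh.1 hh.2, orphanZero]
        | rw [matchZero_of_le (by omega) (by omega), longZero]
        split_ifs
        all_goals
          refine Prod.ext ?_ ?_ <;> dsimp only <;> omega
      · unfold ChordDisj
        dsimp only
        omega
      · unfold Linked Consec Thrackle
        constructor
        · first
          | exact .inl (by omega)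
          | exact .inr (.inl (by omega))
          | exact .inr (.inr (.inl (by omega)))
        · first
          | exact .inl (by omega)
          | exact .inr (.inl (by omega))
          | exact .inr (.inr (.inl (by omega)))
          | exact .inr (.inr (.inr (.inl (by omega))))
          | exact .inr (.inr (.inr (.inr (.inl (by omega)))))
          | exact .inr (.inr (.inr (.inr (.inr (.inl (by omega))))))
  · rw [matchZero_of_le h1 h2, longZero] at hs
    split_ifs at hs
    all_goals
      rw [Prod.mk.injEq] at hs
      obtain ⟨hc, hd⟩ := hs
      have hh : c < d ∧ d < 2 * m := by omega
      first
      | exact .of_fixed (h_eq.trans (by rw [hc, hd])) hab hb (by unfold Thrackle; omega)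
      | refine .of_eq h_eq ?_ hh.1 hh.2 ?_ ?_
        · first
          | rw [matchZero_of_orphan (by omega) (by unfold Orphan; omega) hh.1 hh.2, orphanZero]
          | rw [matchZero_of_le (by omega) (by omega), longZero]
          split_ifs
          all_goals
            refine Prod.ext ?_ ?_ <;> dsimp only <;> omega
        · unfold ChordDisj
          dsimp only
          omega
        · unfold Linked Consec Thrackle
          constructor
          · first
            | exact .inl (by omega)
            | exact .inr (.inl (by omega))
            | exact .inr (.inr (.inl (by omega)))
            | exact .inr (.inr (.inr (by omega)))
          · first
            | exact .inl (by omega)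
            | exact .inr (.inl (by omega))
            | exact .inr (.inr (.inl (by omega)))

theorem Linked.exists_chord {n : ℕ} {H : ℕ → ℕ → Prop} {a b c d : ℕ} (h : Linked n H a b c d)
    (hab : a < b) (hb : b < n) (hcd : c < d) (hd : d < n) :
    ∃ x y, x < y ∧ y < n ∧ H x y ∧ ∀ p q, p < q → q < n → ChordDisj (p, q) (a, b) →
      ChordDisj (p, q) (c, d) → ChordDisj (p, q) (x, y) := by
  have key : ∀ x y, x < y → (x = a ∨ x = b ∨ x = c ∨ x = d) → (y = a ∨ y = b ∨ y = c ∨ y = d) →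
      ∀ p q, p < q → q < n → ChordDisj (p, q) (a, b) →
      ChordDisj (p, q) (c, d) → ChordDisj (p, q) (x, y) := by
    intro x y hxy hx hy p q hpq hq h1 h2
    have h3 := h.1
    unfold Consec at h3
    unfold ChordDisj at *
    dsimp only at *
    omega
  rcases h.2 with ⟨h1, h2⟩ | ⟨h1, h2⟩ | ⟨h1, h2⟩ | ⟨h1, h2⟩ | ⟨h1, h2⟩ | ⟨h1, h2⟩ | ⟨h1, h2⟩ |
    ⟨h1, h2⟩ <;>
  exact ⟨_, _, h1, by omega, h2, key _ _ h1 (by simp) (by simp)⟩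

theorem MatchSpec.exists_chord {n : ℕ} {H : ℕ → ℕ → Prop} {s : ℕ → ℕ → ℕ × ℕ} {a b : ℕ}
    (h : MatchSpec n H s a b) (hab : a < b) (hb : b < n) :
    ∃ x y, x < y ∧ y < n ∧ H x y ∧ ∀ p q, p < q → q < n → ChordDisj (p, q) (a, b) →
      ChordDisj (p, q) (s a b) → ChordDisj (p, q) (x, y) := by
  obtain ⟨hcd, hd, -, ⟨-, hH⟩ | ⟨-, hl⟩⟩ := h
  · exact ⟨a, b, hab, hb, hH, fun p q _ _ h _ => h⟩
  · exact hl.exists_chord hab hb hcd hd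

theorem MatchSpec.not_chordDisj {n : ℕ} {H : ℕ → ℕ → Prop} {s : ℕ → ℕ → ℕ × ℕ} {a b c d : ℕ}
    (hH : ∀ x y z w, x < y → y < n → z < w → w < n → H x y → H z w → ¬ ChordDisj (x, y) (z, w))
    (h : MatchSpec n H s a b) (h' : MatchSpec n H s c d) (hab : a < b) (hb : b < n) (hcd : c < d)
    (hd : d < n) :
    ¬ (ChordDisj (a, b) (c, d) ∧ ChordDisj (a, b) (s c d) ∧ ChordDisj (s a b) (c, d) ∧
      ChordDisj (s a b) (s c d)) := by
  rintro ⟨h1, h2, h3, h4⟩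
  obtain ⟨x, y, hxy, hy, hH1, hx⟩ := h.exists_chord hab hb
  obtain ⟨z, w, hzw, hw, hH2, hz⟩ := h'.exists_chord hcd hd
  exact hH x y z w hxy hy hzw hw hH1 hH2 (hz x y hxy hy (hx c d hcd hd h1.symm h3.symm).symm
    (hx _ _ h'.1 h'.2.1 h2.symm h4.symm).symm)

theorem not_chordDisj_of_thrackle {n m : ℕ} {extra : ℕ × ℕ}
    (hn : n = 2 * m + 1 ∧ extra = (0, m) ∨ n = 2 * m ∧ extra = (m, 2 * m - 1) ∨
      n = 2 * m ∧ extra = (0, m - 1)) {x y z w : ℕ} (hxy : x < y) (hy : y < n) (hzw : z < w)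
    (hw : w < n) (h : Thrackle m extra x y) (h' : Thrackle m extra z w) :
    ¬ ChordDisj (x, y) (z, w) := by
  unfold Thrackle at h h'
  unfold ChordDisj
  rcases hn with ⟨hn, rfl⟩ | ⟨hn, rfl⟩ | ⟨hn, rfl⟩ <;> dsimp only at * <;> omega

/-- The coloring whose classes are the orbits of `s` has at least `n - 1` singleton classes. -/
def ManyFixed (n : ℕ) (s : ℕ → ℕ → ℕ × ℕ) : Prop :=
  ∃ g : ℕ → ℕ × ℕ, (∀ k < n - 1, (g k).1 < (g k).2 ∧ (g k).2 < n ∧ s (g k).1 (g k).2 = g k) ∧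
    ∀ j < n - 1, ∀ k < n - 1, g j = g k → j = k

theorem manyFixed_of_longest {n m : ℕ} {s : ℕ → ℕ → ℕ × ℕ} (hn : n = 2 * m ∨ n = 2 * m + 1)
    (h1 : ∀ a < m, s a (a + m) = (a, a + m))
    (h2 : ∀ a, a + m + 1 < n → s a (a + m + 1) = (a, a + m + 1)) : ManyFixed n s := by
  refine ⟨fun k => if k < m then (k, k + m) else (k - m, k - m + m + 1), fun k hk => ?_,
    fun j hj k hk h => ?_⟩
  · dsimp only
    split_ifs with h
    · exact ⟨by dsimp only; omega, by dsimp only; omega, h1 k h⟩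
    · exact ⟨by dsimp only; omega, by dsimp only; omega, h2 (k - m) (by omega)⟩
  · dsimp only at h
    split_ifs at h <;> rw [Prod.mk.injEq] at h <;> omega

theorem manyFixed_matchTwo {m : ℕ} (hm : m % 2 = 1) : ManyFixed (2 * m) (matchTwo m) := by
  refine ⟨fun k => if k < m then (k, k + m) else if k + 2 = 2 * m then (m, 2 * m - 1) else
    (k - m, k + 1), fun k hk => ?_, fun j hj k hk h => ?_⟩
  · dsimp only
    split_ifs with h h'
    · refine ⟨by dsimp only; omega, by dsimp only; omega, ?_⟩
      rw [matchTwo_of_le (by dsimp only; omega) (by dsimp only; omega), longTwo,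
        if_neg (by dsimp only; omega)]
    · refine ⟨by dsimp only; omega, by dsimp only; omega, ?_⟩
      rw [matchTwo_of_orphan hm (.inr (.inl (by dsimp only; omega))) (by dsimp only; omega)
        (by dsimp only; omega), orphanTwo, if_neg (by dsimp only; omega),
        if_neg (by dsimp only; omega), if_pos rfl]
    · refine ⟨by dsimp only; omega, by dsimp only; omega, ?_⟩
      rw [matchTwo_of_le (by dsimp only; omega) (by dsimp only; omega), longTwo,
        if_neg (by dsimp only; omega)]
  · dsimp only at h
    split_ifs at h <;> rw [Prod.mk.injEq] at h <;> omega

theorem exists_matchSpec {n : ℕ} (h0 : n ≠ 0) (h4 : n ≠ 4) :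
    ∃ (H : ℕ → ℕ → Prop) (s : ℕ → ℕ → ℕ × ℕ), ManyFixed n s ∧
      (∀ a b, a < b → b < n → MatchSpec n H s a b) ∧
      ∀ x y z w, x < y → y < n → z < w → w < n → H x y → H z w → ¬ ChordDisj (x, y) (z, w) := by
  obtain ⟨m, hn⟩ : ∃ m, n = 2 * m ∨ n = 2 * m + 1 := ⟨n / 2, by omega⟩
  rcases Nat.mod_two_eq_zero_or_one m with hm | hm
  · rcases hn with rfl | rfl
    · refine ⟨_, _, manyFixed_of_longest (.inl rfl) (fun a ha => ?_) (fun a ha => ?_),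
        fun a b hab hb => matchSpec_matchZero m a b (by omega) hab hb,
        fun x y z w hxy hy hzw hw => not_chordDisj_of_thrackle (by simp) hxy hy hzw hw⟩
      · rw [matchZero_of_le (by omega) (by omega), longZero, if_neg (by omega),
          if_neg (by omega)]
      · rw [matchZero_of_le (by omega) (by omega), longZero, if_neg (by omega),
          if_neg (by omega)]
    · refine ⟨_, _, manyFixed_of_longest (.inr rfl) (fun a ha => ?_) (fun a ha => ?_),
        fun a b hab hb => matchSpec_matchOne m a b hm hab hb,
        fun x y z w hxy hy hzw hw => not_chordDisj_of_thrackle (by simp) hxy hy hzw hw⟩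
      · rw [matchOne, if_pos rfl, if_neg (by omega)]
      · rw [matchOne, if_neg (by omega), if_pos (by omega)]
  · rcases hn with rfl | rfl
    · exact ⟨_, _, manyFixed_matchTwo hm, fun a b hab hb => matchSpec_matchTwo m a b hm hab hb,
        fun x y z w hxy hy hzw hw => not_chordDisj_of_thrackle (by simp) hxy hy hzw hw⟩
    · refine ⟨_, _, manyFixed_of_longest (.inr rfl) (fun a ha => ?_) (fun a ha => ?_),
        fun a b hab hb => matchSpec_matchThree m a b hm hab hb,
        fun x y z w hxy hy hzw hw => not_chordDisj_of_thrackle (by simp) hxy hy hzw hw⟩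
      · rw [matchThree, if_pos rfl]
      · rw [matchThree, if_neg (by omega), if_pos (by omega)]

/-- The chords of an `n`-gon with vertices `0, …, n - 1`. -/
def chords (n : ℕ) : Finset (ℕ × ℕ) :=
  (Finset.range n).sigma (fun b => Finset.range b) |>.map
    ⟨fun p => (p.2, p.1), fun p q h => by
      obtain ⟨a, b⟩ := p
      obtain ⟨c, d⟩ := q
      simp_all⟩

theorem mem_chords {n : ℕ} {e : ℕ × ℕ} : e ∈ chords n ↔ e.1 < e.2 ∧ e.2 < n := by
  rw [chords, Finset.mem_map]
  constructor
  · rintro ⟨⟨b, a⟩, h, rfl⟩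
    rw [Finset.mem_sigma, Finset.mem_range, Finset.mem_range] at h
    exact h.symm
  · intro h
    refine ⟨⟨e.2, e.1⟩, ?_, rfl⟩
    rw [Finset.mem_sigma, Finset.mem_range, Finset.mem_range]
    exact h.symm

theorem two_mul_card_chords (n : ℕ) : 2 * (chords n).card = n * (n - 1) := by
  rw [chords, Finset.card_map, Finset.card_sigma]
  simp [Finset.sum_range_id_mul_two, mul_comm 2]

theorem exists_chord_coloring {n : ℕ} (h4 : n ≠ 4) :
    ∃ c : ℕ × ℕ → ℕ,
      (∀ e ∈ chords n, ∀ f ∈ chords n, e ≠ f → c e = c f → ChordDisj e f) ∧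
      (∀ e ∈ chords n, ∀ f ∈ chords n, ∃ e' ∈ chords n, ∃ f' ∈ chords n,
        c e' = c e ∧ c f' = c f ∧ ¬ ChordDisj e' f') ∧
      (n ^ 2 + n) / 4 ≤ ((chords n).image c).card := by
  rcases eq_or_ne n 0 with rfl | h0
  · exact ⟨fun _ => 0, by simp [mem_chords], by simp [mem_chords], by simp⟩
  obtain ⟨H, s, ⟨g, hg, hg'⟩, hs, hH⟩ := exists_matchSpec h0 h4
  set σ : ℕ × ℕ → ℕ × ℕ := fun e => s e.1 e.2 with hσ
  have hmem : ∀ e ∈ chords n, σ e ∈ chords n := fun e he => by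
    rw [mem_chords] at *
    have := hs e.1 e.2 he.1 he.2
    exact ⟨this.1, this.2.1⟩
  have hinv : ∀ e ∈ chords n, σ (σ e) = e := fun e he => by
    rw [mem_chords] at he
    exact (hs e.1 e.2 he.1 he.2).2.2.1
  set c : ℕ × ℕ → ℕ := fun e => min (Nat.pair e.1 e.2) (Nat.pair (σ e).1 (σ e).2) with hc
  have hcode : ∀ e f : ℕ × ℕ, Nat.pair e.1 e.2 = Nat.pair f.1 f.2 → e = f := fun e f h => by
    rw [Nat.pair_eq_pair] at h
    exact Prod.ext h.1 h.2
  have hcσ : ∀ e ∈ chords n, c (σ e) = c e := fun e he => by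
    simp only [hc]
    rw [hinv e he, min_comm]
  have hceq : ∀ e ∈ chords n, ∀ f ∈ chords n, c e = c f → f = e ∨ f = σ e := by
    intro e he f hf h
    simp only [hc] at h
    have h' : ∀ x y z w : ℕ, min x y = min z w → x = z ∨ x = w ∨ y = z ∨ y = w := by omega
    rcases h' _ _ _ _ h with h | h | h | h
    · exact .inl (hcode _ _ h).symm
    · exact .inr (by rw [hcode _ _ h, hinv f hf])
    · exact .inr (hcode _ _ h).symm
    · exact .inl (by rw [← hinv f hf, ← hcode _ _ h, hinv e he])
  refine ⟨c, fun e he f hf hne h => ?_, fun e he f hf => ?_, ?_⟩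
  · rcases hceq e he f hf h with rfl | rfl
    · exact absurd rfl hne
    rw [mem_chords] at he
    rcases (hs e.1 e.2 he.1 he.2).2.2.2 with h | h
    · exact absurd h.1.symm hne
    · exact h.1
  · by_contra! h_all
    have h1 := mem_chords.1 he
    have h2 := mem_chords.1 hf
    exact (hs e.1 e.2 h1.1 h1.2).not_chordDisj hH (hs f.1 f.2 h2.1 h2.2) h1.1 h1.2 h2.1 h2.2
      ⟨h_all e he f hf rfl rfl, h_all e he _ (hmem f hf) rfl (hcσ f hf),
        h_all _ (hmem e he) f hf (hcσ e he) rfl,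
        h_all _ (hmem e he) _ (hmem f hf) (hcσ e he) (hcσ f hf)⟩
  · have h_fixed : n - 1 ≤ ((chords n).filter (fun e => σ e = e)).card := by
      have h_inj : Set.InjOn g (Finset.range (n - 1) : Set ℕ) := fun j hj k hk h =>
        hg' j (by simpa using hj) k (by simpa using hk) h
      rw [← Finset.card_range (n - 1), ← Finset.card_image_of_injOn h_inj]
      refine Finset.card_le_card fun e he => ?_
      obtain ⟨k, hk, rfl⟩ := Finset.mem_image.1 he
      obtain ⟨h1, h2, h3⟩ := hg k (by simpa using hk)
      exact Finset.mem_filter.2 ⟨mem_chords.2 ⟨h1, h2⟩, h3⟩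
    have h_count : (chords n).card + ((chords n).filter (fun e => σ e = e)).card ≤
        2 * ((chords n).image c).card := by
      rw [Finset.card_eq_sum_card_image c (chords n),
        Finset.card_eq_sum_card_fiberwise (f := c) (t := (chords n).image c)
          (fun e he => Finset.mem_image_of_mem c (Finset.mem_filter.1 he).1),
        ← Finset.sum_add_distrib, mul_comm, ← smul_eq_mul]
      refine Finset.sum_le_card_nsmul _ _ _ fun i hi => ?_
      obtain ⟨e, he, rfl⟩ := Finset.mem_image.1 hi
      have h_sub : (chords n).filter (fun f => c f = c e) ⊆ {e, σ e} := fun f hf => by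
        rw [Finset.mem_filter] at hf
        simpa using hceq e he f hf.1 hf.2.symm
      by_cases h : σ e = e
      · rw [h, Finset.pair_eq_singleton] at h_sub
        have h1 := Finset.card_le_card h_sub
        have h2 := Finset.card_le_card ((Finset.filter_subset_filter (fun f => c f = c e)
          (Finset.filter_subset (fun e => σ e = e) (chords n))).trans h_sub)
        rw [Finset.card_singleton] at h1 h2
        omega
      · have h1 := (Finset.card_le_card h_sub).trans Finset.card_le_two
        have h2 : (((chords n).filter (fun e => σ e = e)).filter (fun f => c f = c e)) = ∅ := by
          refine Finset.filter_eq_empty_iff.2 fun f hf hfe => ?_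
          rw [Finset.mem_filter] at hf
          rcases hceq e he f hf.1 hfe.symm with rfl | rfl
          · exact h hf.2
          · exact h (hf.2.symm.trans (hinv e he))
        rw [h2, Finset.card_empty]
        exact h1
    have h_chords := two_mul_card_chords n
    obtain ⟨k, rfl⟩ := Nat.exists_eq_succ_of_ne_zero h0
    have h_sq : (k + 1) ^ 2 + (k + 1) = (k + 1) * k + 2 * k + 2 := by ring
    have h_even : (k + 1) * k % 2 = 0 := by
      rw [mul_comm]
      exact Nat.even_iff.1 (Nat.even_mul_succ_self k)
    simp only [Nat.succ_eq_add_one, Nat.add_sub_cancel] at *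
    omega

/-- Twice the signed area of the triangle `p q r`. -/
def signedArea (p q r : Pt) : ℝ :=
  (q.1 - p.1) * (r.2 - p.2) - (q.2 - p.2) * (r.1 - p.1)

theorem signedArea_rotate (p q r : Pt) : signedArea q r p = signedArea p q r := by
  unfold signedArea
  ring

theorem segment_inter_eq_empty {p q r s : Pt} (hr : 0 < signedArea p q r)
    (hs : 0 < signedArea p q s) : segment ℝ p q ∩ segment ℝ r s = ∅ := by
  rw [Set.eq_empty_iff_forall_notMem]
  rintro x ⟨⟨a, b, ha, hb, hab, rfl⟩, ⟨c, d, hc, hd, hcd, hx⟩⟩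
  have h1 := congrArg Prod.fst hx
  have h2 := congrArg Prod.snd hx
  simp only [Prod.fst_add, Prod.smul_fst, Prod.snd_add, Prod.smul_snd, smul_eq_mul] at h1 h2
  have h_zero : c * signedArea p q r + d * signedArea p q s = 0 := by
    have ha' : a = 1 - b := by linarith
    have hc' : c = 1 - d := by linarith
    subst ha' hc'
    unfold signedArea
    linear_combination (q.1 - p.1) * h2 - (q.2 - p.2) * h1
  rcases hc.eq_or_lt with rfl | hc
  · have : d = 1 := by linarith
    subst this
    linarith
  · have := mul_pos hc hr
    have := mul_nonneg hd hs.le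
    linarith

theorem segment_inter_nonempty {p q r s : Pt} (h1 : 0 < signedArea p q r)
    (h2 : 0 < signedArea p q s) (h3 : 0 < signedArea p r s) (h4 : 0 < signedArea q r s) :
    (segment ℝ p r ∩ segment ℝ q s).Nonempty := by
  have h_sum : signedArea p r s + signedArea p q r = signedArea q r s + signedArea p q s := by
    unfold signedArea
    ring
  have h_pos : 0 < signedArea q r s + signedArea p q s := by linarith
  refine ⟨(signedArea q r s / (signedArea q r s + signedArea p q s)) • p +
    (signedArea p q s / (signedArea q r s + signedArea p q s)) • r,
    ⟨_, _, by positivity, by positivity, ?_, rfl⟩,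
    ⟨signedArea p r s / (signedArea q r s + signedArea p q s),
      signedArea p q r / (signedArea q r s + signedArea p q s),
      by positivity, by positivity, ?_, ?_⟩⟩
  · field_simp
  · rw [← h_sum]
    field_simp
  · refine Prod.ext ?_ ?_
    all_goals
      simp only [Prod.fst_add, Prod.smul_fst, Prod.snd_add, Prod.smul_snd, smul_eq_mul]
      field_simp
      unfold signedArea
      ring

theorem Finset.exists_strictMono_enum {α β : Type*} [Nonempty α] [DecidableEq α] [LinearOrder β]
    (f : α → β) (s : Finset α) (hf : Set.InjOn f s) :
    ∃ v : ℕ → α, s = (Finset.range s.card).image v ∧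
      ∀ i j, i < j → j < s.card → f (v i) < f (v j) := by
  induction s using Finset.induction_on_max_value f with
  | empty => exact ⟨fun _ => Classical.arbitrary α, by simp, by simp⟩
  | insert a s ha h_max ih =>
    obtain ⟨v, hv, hv'⟩ := ih (hf.mono (by simp))
    rw [Finset.card_insert_of_notMem ha]
    have h_mem : ∀ i < s.card, v i ∈ s := fun i hi => by
      rw [hv]
      exact Finset.mem_image_of_mem v (Finset.mem_range.2 hi)
    refine ⟨Function.update v s.card a, ?_, fun i j hij hj => ?_⟩
    · rw [Finset.range_add_one, Finset.image_insert, Function.update_self]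
      nth_rw 1 [hv]
      congr 1
      refine Finset.image_congr fun i hi => ?_
      rw [Function.update_of_ne (Finset.mem_range.1 hi).ne]
    · rw [Function.update_of_ne (by omega) a v]
      rcases (Nat.lt_succ_iff.1 hj).eq_or_lt with rfl | hj
      · rw [Function.update_self]
        have h_in := h_mem i hij
        refine (h_max _ h_in).lt_of_ne fun h => ha ?_
        rw [← hf (Finset.mem_insert_of_mem h_in) (Finset.mem_insert_self a s) h]
        exact h_in
      · rw [Function.update_of_ne hj.ne]
        exact hv' i j hij hj

/-- `v` enumerates the vertices of a convex `n`-gon counterclockwise. -/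
def IsConvexEnum (n : ℕ) (v : ℕ → Pt) : Prop :=
  ∀ i j k, i < j → j < k → k < n → 0 < signedArea (v i) (v j) (v k)

theorem IsConvexEnum.segment_inter_eq_empty {n : ℕ} {v : ℕ → Pt} (hv : IsConvexEnum n v)
    {e f : ℕ × ℕ} (he : e ∈ chords n) (hf : f ∈ chords n) (h : ChordDisj e f) :
    segment ℝ (v e.1) (v e.2) ∩ segment ℝ (v f.1) (v f.2) = ∅ := by
  rw [mem_chords] at he hf
  have h_nested : ∀ a b c d, a < c → c < d → d < b → b < n →
      segment ℝ (v a) (v b) ∩ segment ℝ (v c) (v d) = ∅ := fun a b c d h1 h2 h3 h4 => by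
    rw [segment_symm ℝ (v a) (v b)]
    apply _root_.segment_inter_eq_empty
    · rw [← signedArea_rotate]
      exact hv _ _ _ h1 (h2.trans h3) h4
    · rw [← signedArea_rotate]
      exact hv _ _ _ (h1.trans h2) h3 h4
  rcases h with h | h | h | h
  · exact _root_.segment_inter_eq_empty (hv _ _ _ he.1 h (hf.1.trans hf.2))
      (hv _ _ _ he.1 (h.trans hf.1) hf.2)
  · rw [Set.inter_comm]
    exact _root_.segment_inter_eq_empty (hv _ _ _ hf.1 h (he.1.trans he.2))
      (hv _ _ _ hf.1 (h.trans he.1) he.2)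
  · exact h_nested _ _ _ _ h.1 hf.1 h.2 he.2
  · rw [Set.inter_comm]
    exact h_nested _ _ _ _ h.1 he.1 h.2 hf.2

theorem IsConvexEnum.segment_inter_nonempty {n : ℕ} {v : ℕ → Pt} (hv : IsConvexEnum n v)
    {e f : ℕ × ℕ} (he : e ∈ chords n) (hf : f ∈ chords n) (h : ¬ ChordDisj e f) :
    (segment ℝ (v e.1) (v e.2) ∩ segment ℝ (v f.1) (v f.2)).Nonempty := by
  rw [mem_chords] at he hf
  unfold ChordDisj at h
  have h_cross : ∀ a b c d, a < c → c < b → b < d → d < n →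
      (segment ℝ (v a) (v b) ∩ segment ℝ (v c) (v d)).Nonempty := fun a b c d h1 h2 h3 h4 =>
    _root_.segment_inter_nonempty (hv _ _ _ h1 h2 (h3.trans h4)) (hv _ _ _ h1 (h2.trans h3) h4)
      (hv _ _ _ (h1.trans h2) h3 h4) (hv _ _ _ h2 h3 h4)
  have h_cases : e.1 = f.1 ∨ e.1 = f.2 ∨ e.2 = f.1 ∨ e.2 = f.2 ∨
      (e.1 < f.1 ∧ f.1 < e.2 ∧ e.2 < f.2) ∨ (f.1 < e.1 ∧ e.1 < f.2 ∧ f.2 < e.2) := by omega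
  rcases h_cases with h | h | h | h | h | h
  · exact ⟨_, left_mem_segment _ _ _, h ▸ left_mem_segment _ _ _⟩
  · exact ⟨_, left_mem_segment _ _ _, h ▸ right_mem_segment _ _ _⟩
  · exact ⟨_, right_mem_segment _ _ _, h ▸ left_mem_segment _ _ _⟩
  · exact ⟨_, right_mem_segment _ _ _, h ▸ right_mem_segment _ _ _⟩
  · exact h_cross _ _ _ _ h.1 h.2.1 h.2.2 hf.2
  · rw [Set.inter_comm]
    exact h_cross _ _ _ _ h.1 h.2.1 h.2.2 he.2

theorem mem_edgeSet_image_iff {n : ℕ} {v : ℕ → Pt} (hv : Set.InjOn v (Finset.range n))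
    {e : Sym2 Pt} :
    e ∈ edgeSet ((Finset.range n).image v) ↔ ∃ p ∈ chords n, e = s(v p.1, v p.2) := by
  unfold edgeSet
  rw [Finset.mem_filter, Finset.mem_sym2_iff]
  constructor
  · rintro ⟨h_mem, h_diag⟩
    induction e with
    | _ x y =>
      obtain ⟨a, ha, rfl⟩ := Finset.mem_image.1 (h_mem x (Sym2.mem_mk_left x y))
      obtain ⟨b, hb, rfl⟩ := Finset.mem_image.1 (h_mem y (Sym2.mem_mk_right _ y))
      rw [Finset.mem_range] at ha hb
      have h_ne : a ≠ b := fun h => h_diag (by rw [h]; exact rfl)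
      rcases h_ne.lt_or_gt with h | h
      · exact ⟨(a, b), mem_chords.2 ⟨h, hb⟩, rfl⟩
      · exact ⟨(b, a), mem_chords.2 ⟨h, ha⟩, Sym2.eq_swap⟩
  · rintro ⟨p, hp, rfl⟩
    rw [mem_chords] at hp
    have h1 : p.1 ∈ Finset.range n := Finset.mem_range.2 (hp.1.trans hp.2)
    have h2 : p.2 ∈ Finset.range n := Finset.mem_range.2 hp.2
    refine ⟨fun x hx => ?_, fun h => hp.1.ne (hv h1 h2 h)⟩
    rcases Sym2.mem_iff.1 hx with rfl | rfl
    · exact Finset.mem_image_of_mem v h1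
    · exact Finset.mem_image_of_mem v h2

/-- The color, under a coloring `c` of the chords, of the segments whose endpoints are numbered by
`r`. -/
def liftColoring (r : Pt → ℕ) (c : ℕ × ℕ → ℕ) : Sym2 Pt → ℕ :=
  Sym2.lift ⟨fun x y => c (min (r x) (r y), max (r x) (r y)), fun x y => by
    dsimp only
    rw [min_comm, max_comm]⟩

theorem liftColoring_mk {r : Pt → ℕ} {c : ℕ × ℕ → ℕ} {n : ℕ} {v : ℕ → Pt}
    (hr : ∀ i < n, r (v i) = i) {p : ℕ × ℕ} (hp : p ∈ chords n) :
    liftColoring r c s(v p.1, v p.2) = c p := by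
  rw [mem_chords] at hp
  rw [liftColoring, Sym2.lift_mk]
  dsimp only
  rw [hr _ hp.2, hr _ (hp.1.trans hp.2), min_eq_left hp.1.le, max_eq_right hp.1.le]

theorem linearMap_apply_eq (f : Pt →ₗ[ℝ] ℝ) (v : Pt) : f v = f (1, 0) * v.1 + f (0, 1) * v.2 := by
  conv_lhs => rw [show v = v.1 • ((1, 0) : Pt) + v.2 • ((0, 1) : Pt) by ext <;> simp]
  rw [map_add, map_smul, map_smul, smul_eq_mul, smul_eq_mul]
  ring

theorem collinear_of_signedArea_eq_zero {p q r : Pt} (f : Pt →ₗ[ℝ] ℝ) (hq : f (q - p) ≠ 0)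
    (h : signedArea p q r = 0) : Collinear ℝ ({p, q, r} : Set Pt) := by
  rw [collinear_iff_of_mem (Set.mem_insert p {q, r})]
  refine ⟨q - p, fun x hx => ?_⟩
  rcases hx with rfl | rfl | rfl
  · exact ⟨0, by simp⟩
  · exact ⟨1, by simp⟩
  · refine ⟨f (x - p) / f (q - p), ?_⟩
    rw [vadd_eq_add, ← sub_eq_iff_eq_add]
    unfold signedArea at h
    refine Prod.ext ?_ ?_
    all_goals
      rw [linearMap_apply_eq f (q - p)] at hq
      rw [linearMap_apply_eq f (x - p), linearMap_apply_eq f (q - p)]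
      simp only [Prod.fst_sub, Prod.snd_sub, Prod.smul_fst, Prod.smul_snd, smul_eq_mul] at hq ⊢
      field_simp
    · linear_combination (-f (0, 1)) * h
    · linear_combination f (1, 0) * h

theorem mem_convexHull_of_signedArea_nonpos {p q r s : Pt} (h1 : 0 < signedArea p q r)
    (h2 : 0 < signedArea p r s) (h3 : 0 < signedArea p q s) (h : signedArea q r s ≤ 0) :
    r ∈ convexHull ℝ ({p, q, s} : Set Pt) := by
  have h_sum : signedArea q r s = signedArea p q r + signedArea p r s - signedArea p q s := by
    unfold signedArea
    ring
  have h_comb : r = ∑ i, (![-signedArea q r s / signedArea p q s,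
      signedArea p r s / signedArea p q s, signedArea p q r / signedArea p q s] : Fin 3 → ℝ) i •
      (![p, q, s] : Fin 3 → Pt) i := by
    rw [Fin.sum_univ_three]
    refine Prod.ext ?_ ?_
    all_goals
      simp only [Matrix.cons_val, Prod.fst_add, Prod.smul_fst, Prod.snd_add, Prod.smul_snd,
        smul_eq_mul]
      field_simp
      unfold signedArea
      ring
  rw [h_comb]
  refine (convex_convexHull ℝ _).sum_mem (fun i _ => ?_) ?_ (fun i _ => subset_convexHull ℝ _ ?_)
  · fin_cases i
    · exact div_nonneg (neg_nonneg.2 h) h3.le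
    · exact div_nonneg h2.le h3.le
    · exact div_nonneg h1.le h3.le
  · rw [Fin.sum_univ_three]
    simp only [Matrix.cons_val]
    field_simp
    linarith
  · fin_cases i <;> simp

/-- The slope of `v` with respect to the frame given by `f` and the quarter turn of its gradient. -/
noncomputable def frameSlope (f : Pt →ₗ[ℝ] ℝ) (v : Pt) : ℝ :=
  (f (1, 0) * v.2 - f (0, 1) * v.1) / f v

theorem frameSlope_sub_frameSlope (f : Pt →ₗ[ℝ] ℝ) {p q r : Pt} (hq : 0 < f (q - p))
    (hr : 0 < f (r - p)) :
    frameSlope f (r - p) - frameSlope f (q - p) =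
      (f (1, 0) ^ 2 + f (0, 1) ^ 2) / (f (q - p) * f (r - p)) * signedArea p q r := by
  unfold frameSlope
  have hq' := hq.ne'
  have hr' := hr.ne'
  field_simp
  rw [linearMap_apply_eq f (q - p), linearMap_apply_eq f (r - p)]
  unfold signedArea
  simp only [Prod.fst_sub, Prod.snd_sub]
  ring

theorem exists_convexEnum {S : Finset Pt} (hgp : GenPos S) (hconv : ConvexPos S) :
    ∃ v : ℕ → Pt, S = (Finset.range S.card).image v ∧ IsConvexEnum S.card v := by
  rcases S.eq_empty_or_nonempty with rfl | ⟨p, hp⟩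
  · exact ⟨fun _ => 0, by simp, fun i j k _ _ hk => by simp at hk⟩
  obtain ⟨F, u, hu, hF⟩ := geometric_hahn_banach_point_closed (convex_convexHull ℝ _)
    ((S.finite_toSet.sdiff (t := {p})).isClosed_convexHull ℝ) (hconv p hp)
  set f : Pt →ₗ[ℝ] ℝ := F.toLinearMap with hf_def
  have hf : ∀ q ∈ S, q ≠ p → 0 < f (q - p) := fun q hq hqp => by
    have := hF q (subset_convexHull ℝ _ ⟨hq, hqp⟩)
    rw [map_sub, sub_pos]
    exact hu.trans this
  set key : Pt → WithBot ℝ := fun q => if q = p then ⊥ else (frameSlope f (q - p) : ℝ) with hkey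
  have h_area : ∀ q ∈ S, q ≠ p → ∀ r ∈ S, r ≠ p → q ≠ r → signedArea p q r ≠ 0 :=
    fun q hq hqp r hr hrp hqr h => hgp p hp q hq r hr hqp.symm hqr hrp.symm
      (collinear_of_signedArea_eq_zero f (hf q hq hqp).ne' h)
  have h_pos : ∀ q ∈ S, q ≠ p → 0 < f (1, 0) ^ 2 + f (0, 1) ^ 2 := fun q hq hqp => by
    have := hf q hq hqp
    rw [linearMap_apply_eq] at this
    by_contra! h
    have h1 : f (1, 0) = 0 := by nlinarith [sq_nonneg (f (1, 0)), sq_nonneg (f (0, 1))]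
    have h2 : f (0, 1) = 0 := by nlinarith [sq_nonneg (f (1, 0)), sq_nonneg (f (0, 1))]
    rw [h1, h2] at this
    linarith
  have h_bot : ∀ q, key q = ⊥ → q = p := fun q h => by
    by_contra hqp
    simp [hkey, hqp] at h
  have h_key_inj : Set.InjOn key S := fun q hq r hr h => by
    by_cases hqp : q = p
    · rw [hqp] at h ⊢
      exact (h_bot r (by rw [← h]; simp [hkey])).symm
    by_cases hrp : r = p
    · rw [hrp] at h ⊢
      exact h_bot q (by rw [h]; simp [hkey])
    by_contra hqr
    simp only [hkey, if_neg hqp, if_neg hrp, WithBot.coe_inj] at h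
    have h_eq := frameSlope_sub_frameSlope f (hf q hq hqp) (hf r hr hrp)
    rw [h, sub_self] at h_eq
    have := mul_pos (hf q hq hqp) (hf r hr hrp)
    have := div_pos (h_pos q hq hqp) this
    exact mul_ne_zero this.ne' (h_area q hq hqp r hr hrp hqr) h_eq.symm
  have h_area_pos : ∀ q ∈ S, ∀ r ∈ S, q ≠ p → key q < key r → 0 < signedArea p q r := by
    intro q hq r hr hqp h
    have hrp : r ≠ p := fun hrp => by simp [hkey, hrp] at h
    simp only [hkey, if_neg hqp, if_neg hrp, WithBot.coe_lt_coe] at h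
    rw [← sub_pos, frameSlope_sub_frameSlope f (hf q hq hqp) (hf r hr hrp)] at h
    have := mul_pos (hf q hq hqp) (hf r hr hrp)
    have := div_pos (h_pos q hq hqp) this
    exact (mul_pos_iff_of_pos_left this).1 h
  obtain ⟨v, hv, hv_lt⟩ := S.exists_strictMono_enum key h_key_inj
  refine ⟨v, hv, fun i j k hij hjk hk => ?_⟩
  have h_mem : ∀ i < S.card, v i ∈ S := fun i hi => by
    rw [hv]
    exact Finset.mem_image_of_mem v (Finset.mem_range.2 hi)
  have h_ne : ∀ i j, i < j → j < S.card → v j ≠ p := fun i j hij hj h => by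
    have := hv_lt i j hij hj
    simp [hkey, h] at this
  have h_fan : ∀ i j, i < j → j < S.card → v i ≠ p → 0 < signedArea p (v i) (v j) :=
    fun i j hij hj hi => h_area_pos _ (h_mem i (hij.trans hj)) _ (h_mem j hj) hi (hv_lt i j hij hj)
  by_cases hi : v i = p
  · rw [hi]
    exact h_fan j k hjk hk (h_ne i j hij (hjk.trans hk))
  · by_contra! h
    have h_hull := mem_convexHull_of_signedArea_nonpos (h_fan i j hij (hjk.trans hk) hi)
      (h_fan j k hjk hk (h_ne i j hij (hjk.trans hk))) (h_fan i k (hij.trans hjk) hk hi) h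
    refine hconv _ (h_mem j (hjk.trans hk)) (convexHull_mono ?_ h_hull)
    rintro x (rfl | rfl | rfl)
    · exact ⟨hp, (h_ne i j hij (hjk.trans hk)).symm⟩
    · refine ⟨h_mem i (hij.trans (hjk.trans hk)), fun h => ?_⟩
      have := hv_lt i j hij (hjk.trans hk)
      rw [h] at this
      exact lt_irrefl _ this
    · refine ⟨h_mem k hk, fun h => ?_⟩
      have := hv_lt j k hjk hk
      rw [h] at this
      exact lt_irrefl _ this

/-- For `n ≠ 4`, the achromatic index of the complete convex geometric graph on `n`
vertices is at least `⌊(n² + n)/4⌋`. -/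
theorem achromatic_lower (S : Finset Pt) (n : ℕ) (hn : S.card = n) (h4 : n ≠ 4)
    (hgp : GenPos S) (hconv : ConvexPos S) :
    ∃ c : Sym2 Pt → ℕ, ProperOn (edgeSet S) c ∧ CompleteOn (edgeSet S) c ∧
      (n ^ 2 + n) / 4 ≤ ((edgeSet S).image c).card := by
  obtain ⟨v, hS, hv⟩ := exists_convexEnum hgp hconv
  rw [hn] at hS hv
  have h_inj : Set.InjOn v (Finset.range n) := by
    rw [← Finset.card_image_iff, ← hS, hn, Finset.card_range]
  obtain ⟨c, h_proper, h_complete, h_card⟩ := exists_chord_coloring h4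
  have hr : ∀ i < n, Function.invFunOn v (Finset.range n) (v i) = i := fun i hi =>
    h_inj.leftInvOn_invFunOn (by simpa using hi)
  set C := liftColoring (Function.invFunOn v (Finset.range n)) c
  have hC : ∀ p ∈ chords n, C s(v p.1, v p.2) = c p := fun p hp => liftColoring_mk hr hp
  have h_mem : ∀ e, e ∈ edgeSet S ↔ ∃ p ∈ chords n, e = s(v p.1, v p.2) := fun e => by
    rw [hS]
    exact mem_edgeSet_image_iff h_inj
  refine ⟨C, fun e he f hf hne h => ?_, fun i hi j hj _ => ?_, h_card.trans ?_⟩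
  · obtain ⟨p, hp, rfl⟩ := (h_mem e).1 he
    obtain ⟨q, hq, rfl⟩ := (h_mem f).1 hf
    rw [hC p hp, hC q hq] at h
    rw [SInter, Set.not_nonempty_iff_eq_empty]
    exact hv.segment_inter_eq_empty hp hq (h_proper p hp q hq (fun h' => hne (by rw [h'])) h)
  · obtain ⟨e, he, rfl⟩ := Finset.mem_image.1 hi
    obtain ⟨f, hf, rfl⟩ := Finset.mem_image.1 hj
    obtain ⟨p, hp, rfl⟩ := (h_mem e).1 he
    obtain ⟨q, hq, rfl⟩ := (h_mem f).1 hf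
    obtain ⟨p', hp', q', hq', h1, h2, h3⟩ := h_complete p hp q hq
    exact ⟨_, (h_mem _).2 ⟨p', hp', rfl⟩, _, (h_mem _).2 ⟨q', hq', rfl⟩,
      by rw [hC p' hp', hC p hp, h1], by rw [hC q' hq', hC q hq, h2],
      hv.segment_inter_nonempty hp' hq' h3⟩
  · refine Finset.card_le_card fun i hi => ?_
    obtain ⟨p, hp, rfl⟩ := Finset.mem_image.1 hi
    exact Finset.mem_image.2 ⟨_, (h_mem _).2 ⟨p, hp, rfl⟩, hC p hp⟩
end

section
/- For every n ≠ 4, the achromatic index and the pseudoachromatic index of the complete convex geometric graph on n vertices are both equal to floor((n^2+n)/4). -/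
open scoped Classical

/-- Twice the signed area of the triangle `pqr`. -/
noncomputable def orient (p q r : Pt) : ℝ :=
  (q.1 - p.1) * (r.2 - p.2) - (q.2 - p.2) * (r.1 - p.1)

lemma orient_ne_zero {S : Finset Pt} (h : GenPos S) {p q r : Pt} (hp : p ∈ S) (hq : q ∈ S)
    (hr : r ∈ S) (hpq : p ≠ q) (hqr : q ≠ r) (hpr : p ≠ r) : orient p q r ≠ 0 := by
  intro h0
  refine h p hp q hq r hr hpq hqr hpr ?_
  rw [collinear_iff_of_mem (p₀ := p) (by simp)]
  refine ⟨q - p, ?_⟩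
  unfold orient at h0
  intro x hx
  simp only [Set.mem_insert_iff, Set.mem_singleton_iff] at hx
  rcases hx with rfl | rfl | rfl
  · exact ⟨0, by simp⟩
  · exact ⟨1, by simp⟩
  · by_cases h1 : q.1 - p.1 = 0
    · have h2 : q.2 - p.2 ≠ 0 := fun h2 => hpq (Prod.ext (by linarith) (by linarith))
      have h3 : x.1 - p.1 = 0 := by
        rw [h1] at h0
        simpa [h2] using h0
      refine ⟨(x.2 - p.2) / (q.2 - p.2), Prod.ext ?_ ?_⟩
      · simp [h1]
        linarith
      · simp
        field_simp
        ring
    · refine ⟨(x.1 - p.1) / (q.1 - p.1), Prod.ext ?_ ?_⟩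
      · simp
        field_simp
        ring
      · simp
        field_simp
        linarith

/-- `p` precedes `q` in the lexicographic order. -/
def LexLT (p q : Pt) : Prop := p.1 < q.1 ∨ (p.1 = q.1 ∧ p.2 < q.2)

lemma exists_lexMin {S : Finset Pt} (h : S.Nonempty) : ∃ o ∈ S, ∀ q ∈ S, q ≠ o → LexLT o q := by
  obtain ⟨o, ho, hm⟩ := S.exists_min_image (fun p : Pt => toLex p) h
  refine ⟨o, ho, fun q hq hne => ?_⟩
  have := lt_of_le_of_ne (hm q hq) (fun h => hne (toLex.injective h).symm)
  rwa [Prod.Lex.toLex_lt_toLex] at this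

lemma orient_trans {o q r s : Pt} (hq : LexLT o q) (hr : LexLT o r) (hs : LexLT o s)
    (h1 : 0 < orient o q r) (h2 : 0 < orient o r s) : 0 < orient o q s := by
  unfold orient LexLT at *
  obtain ⟨a, b⟩ := o
  obtain ⟨q1, q2⟩ := q
  obtain ⟨r1, r2⟩ := r
  obtain ⟨s1, s2⟩ := s
  simp only at *
  obtain ⟨u1, rfl⟩ : ∃ u, q1 = a + u := ⟨q1 - a, by ring⟩
  obtain ⟨v1, rfl⟩ : ∃ u, r1 = a + u := ⟨r1 - a, by ring⟩
  obtain ⟨w1, rfl⟩ : ∃ u, s1 = a + u := ⟨s1 - a, by ring⟩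
  obtain ⟨u2, rfl⟩ : ∃ u, q2 = b + u := ⟨q2 - b, by ring⟩
  obtain ⟨v2, rfl⟩ : ∃ u, r2 = b + u := ⟨r2 - b, by ring⟩
  obtain ⟨w2, rfl⟩ : ∃ u, s2 = b + u := ⟨s2 - b, by ring⟩
  simp only [add_sub_cancel_left, lt_add_iff_pos_right, left_eq_add] at *
  have id1 : (u1 * w2 - u2 * w1) * v1 = (u1 * v2 - u2 * v1) * w1 + (v1 * w2 - v2 * w1) * u1 := by
    ring
  have hu : 0 ≤ u1 := by rcases hq with h | h <;> linarith
  have hw : 0 ≤ w1 := by rcases hs with h | h <;> linarith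
  rcases hr with hv | ⟨hv, hv2⟩
  · refine pos_of_mul_pos_left (b := v1) ?_ hv.le
    rw [id1]
    rcases hw.lt_or_eq with hw | hw
    · have := mul_pos h1 hw
      have := mul_nonneg h2.le hu
      linarith
    · rcases hu.lt_or_eq with hu | hu
      · have := mul_nonneg h1.le hw.le
        have := mul_pos h2 hu
        linarith
      · subst hu
        have : 0 < u2 := by rcases hq with h | h <;> linarith
        nlinarith
  · subst hv
    nlinarith

lemma orient_swap (o q r : Pt) : orient o r q = -orient o q r := by
  unfold orient
  ring

lemma exists_equiv_fin_of_isStrictTotalOrder {α : Type*} [Fintype α] (r : α → α → Prop)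
    [IsStrictTotalOrder α r] {n : ℕ} (h : Fintype.card α = n) :
    ∃ e : Fin n ≃ α, ∀ i j, i < j → r (e i) (e j) := by
  let _ : LinearOrder α := linearOrderOfSTO r
  let e := Fintype.orderIsoFinOfCardEq α h
  exact ⟨e.toEquiv, fun i j hij => e.lt_iff_lt.2 hij⟩

/-- The points of a finite set in convex position can be listed counterclockwise. -/
lemma exists_ccw_enum {S : Finset Pt} (hgp : GenPos S) (hconv : ConvexPos S) :
    ∃ p : ℕ → Pt, (∀ x, x ∈ S ↔ ∃ i < S.card, p i = x) ∧
      (∀ i < S.card, ∀ j < S.card, p i = p j → i = j) ∧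
      ∀ i j k, i < j → j < k → k < S.card → 0 < orient (p i) (p j) (p k) := by
  rcases S.eq_empty_or_nonempty with rfl | hne
  · exact ⟨fun _ => 0, by simp⟩
  obtain ⟨o, ho, hmin⟩ := exists_lexMin hne
  let r : S → S → Prop := fun q s =>
    (q.1 = o ∧ s.1 ≠ o) ∨ (q.1 ≠ o ∧ s.1 ≠ o ∧ 0 < orient o q s)
  have hself : ∀ q : Pt, orient o q q = 0 := fun q => by unfold orient; ring
  have : IsStrictTotalOrder S r :=
    { trichotomous := by
        intro q s h1 h2
        by_contra hqs
        have hqs' : q.1 ≠ s.1 := fun h => hqs (Subtype.ext h)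
        simp only [r, not_or, not_and, not_lt] at h1 h2
        by_cases hq : q.1 = o
        · exact h1.1 hq (fun h => hqs' (hq.trans h.symm))
        · by_cases hs : s.1 = o
          · exact h2.1 hs hq
          · have a1 := h1.2 hq hs
            have a2 := h2.2 hs hq
            rw [orient_swap] at a2
            exact orient_ne_zero hgp ho q.2 s.2 (Ne.symm hq) hqs' (Ne.symm hs) (by linarith)
      irrefl := by
        intro q h
        simp only [r, hself, lt_irrefl] at h
        tauto
      trans := by
        intro q s t h1 h2
        simp only [r] at *
        rcases h1 with h1 | h1 <;> rcases h2 with h2 | h2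
        · exact absurd h2.1 h1.2
        · exact Or.inl ⟨h1.1, h2.2.1⟩
        · exact absurd h2.1 h1.2.1
        · exact Or.inr ⟨h1.1, h2.2.1, orient_trans (hmin _ q.2 h1.1) (hmin _ s.2 h2.1)
            (hmin _ t.2 h2.2.1) h1.2.2 h2.2.2⟩ }
  obtain ⟨e, hr⟩ := exists_equiv_fin_of_isStrictTotalOrder r (n := S.card) (by simp)
  refine ⟨fun i => if h : i < S.card then (e ⟨i, h⟩).1 else o, ?_, ?_, ?_⟩
  · intro x
    constructor
    · intro hx
      refine ⟨(e.symm ⟨x, hx⟩).1, (e.symm ⟨x, hx⟩).2, ?_⟩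
      simp
    · rintro ⟨i, hi, rfl⟩
      simp [hi]
  · intro i hi j hj h
    simp only [hi, hj, dif_pos] at h
    simpa using e.injective (Subtype.ext h)
  · intro i j k hij hjk hk
    have hj := hjk.trans hk
    have hi := hij.trans hj
    simp only [hi, hj, hk, dif_pos]
    have rij := hr ⟨i, hi⟩ ⟨j, hj⟩ hij
    have rjk := hr ⟨j, hj⟩ ⟨k, hk⟩ hjk
    have rik := hr ⟨i, hi⟩ ⟨k, hk⟩ (hij.trans hjk)
    have nij : (e ⟨i, hi⟩).1 ≠ (e ⟨j, hj⟩).1 := fun h => by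
      have := e.injective (Subtype.ext h)
      simp at this
      omega
    have njk : (e ⟨j, hj⟩).1 ≠ (e ⟨k, hk⟩).1 := fun h => by
      have := e.injective (Subtype.ext h)
      simp at this
      omega
    have nik : (e ⟨i, hi⟩).1 ≠ (e ⟨k, hk⟩).1 := fun h => by
      have := e.injective (Subtype.ext h)
      simp at this
      omega
    have mi := (e ⟨i, hi⟩).2
    have mj := (e ⟨j, hj⟩).2
    have mk := (e ⟨k, hk⟩).2
    simp only [r] at rij rjk rik
    generalize (e ⟨i, hi⟩).1 = P at *
    generalize (e ⟨j, hj⟩).1 = Q at *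
    generalize (e ⟨k, hk⟩).1 = R at *
    have hQ : Q ≠ o := by tauto
    have hR : R ≠ o := by tauto
    have oQR : 0 < orient o Q R := by tauto
    by_cases hP : P = o
    · rw [hP]
      exact oQR
    have oPQ : 0 < orient o P Q := by tauto
    have oPR : 0 < orient o P R := by tauto
    rcases (orient_ne_zero hgp mi mj mk nij njk nik).lt_or_gt with hneg | hpos
    swap
    · exact hpos
    exfalso
    refine hconv Q mj ?_
    have hmem : ∀ x ∈ S, x ≠ Q → x ∈ convexHull ℝ ((S : Set Pt) \ {Q}) :=
      fun x hx hne => subset_convexHull ℝ _ ⟨hx, hne⟩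
    have hc := (convex_convexHull ℝ ((S : Set Pt) \ {Q})).sum_mem
      (t := (Finset.univ : Finset (Fin 3)))
      (w := ![orient o Q R / orient o P R, orient o P Q / orient o P R,
        -orient P Q R / orient o P R]) (z := ![P, R, o])
      (by
        intro i _
        fin_cases i
        · exact div_nonneg oQR.le oPR.le
        · exact div_nonneg oPQ.le oPR.le
        · exact div_nonneg (by linarith) oPR.le)
      (by
        simp only [Fin.sum_univ_three, Matrix.cons_val]
        field_simp
        unfold orient
        ring)
      (by
        intro i _
        fin_cases i
        · exact hmem _ mi nij
        · exact hmem _ mk njk.symm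
        · exact hmem _ ho hQ.symm)
    convert hc using 1
    simp only [Fin.sum_univ_three, Matrix.cons_val]
    have h0 : orient o P R ≠ 0 := oPR.ne'
    refine Prod.ext ?_ ?_
    · simp only [Prod.fst_add, Prod.smul_fst, smul_eq_mul]
      field_simp
      unfold orient
      ring
    · simp only [Prod.snd_add, Prod.smul_snd, smul_eq_mul]
      field_simp
      unfold orient
      ring

/-- The chords `xy` and `uv` of a convex polygon share an endpoint or cross. -/
def Meets (x y u v : ℕ) : Prop :=
  u = x ∨ u = y ∨ v = x ∨ v = y ∨
    (((x < u ∧ u < y) ∨ (y < u ∧ u < x)) ↔ ¬((x < v ∧ v < y) ∨ (y < v ∧ v < x)))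

lemma segment_inter_of_crossing {a b c d : Pt} (h1 : 0 < orient a b c) (h2 : 0 < orient a b d)
    (h3 : 0 < orient a c d) (h4 : 0 < orient b c d) : (segment ℝ a c ∩ segment ℝ b d).Nonempty := by
  have hs : orient b c d + orient a b d = orient a c d + orient a b c := by
    unfold orient
    ring
  have hp : 0 < orient b c d + orient a b d := by linarith
  refine ⟨(orient b c d / (orient b c d + orient a b d)) • a +
    (orient a b d / (orient b c d + orient a b d)) • c, ⟨_, _, by positivity, by positivity,
      by field_simp, rfl⟩, orient a c d / (orient b c d + orient a b d),
      orient a b c / (orient b c d + orient a b d), by positivity, by positivity,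
      by field_simp; linarith, ?_⟩
  have h0 := hp.ne'
  refine Prod.ext ?_ ?_
  · simp only [Prod.fst_add, Prod.smul_fst, smul_eq_mul]
    field_simp
    unfold orient
    ring
  · simp only [Prod.snd_add, Prod.smul_snd, smul_eq_mul]
    field_simp
    unfold orient
    ring

lemma segment_disjoint_of_orient {a b c d : Pt} (h1 : 0 < orient a b c) (h2 : 0 < orient a b d) :
    ¬(segment ℝ a b ∩ segment ℝ c d).Nonempty := by
  rintro ⟨x, ⟨s, t, hs, ht, hst, rfl⟩, u, v, hu, hv, huv, hx⟩
  have e1 := congrArg Prod.fst hx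
  have e2 := congrArg Prod.snd hx
  simp only [Prod.fst_add, Prod.smul_fst, Prod.snd_add, Prod.smul_snd, smul_eq_mul] at e1 e2
  have key : u * orient a b c + v * orient a b d = 0 := by
    unfold orient
    obtain rfl : s = 1 - t := by linarith
    obtain rfl : u = 1 - v := by linarith
    linear_combination (b.1 - a.1) * e2 - (b.2 - a.2) * e1
  rcases hu.lt_or_eq with h | h
  · have := mul_pos h h1
    have := mul_nonneg hv h2.le
    linarith
  · have : 0 < v := by linarith
    have := mul_pos this h2
    have := mul_nonneg hu h1.le
    linarith

lemma orient_rotate (a b c : Pt) : orient b c a = orient a b c := by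
  unfold orient
  ring

lemma segment_inter_iff_meets_of_lt {n : ℕ} {p : ℕ → Pt}
    (hp : ∀ i j k, i < j → j < k → k < n → 0 < orient (p i) (p j) (p k))
    {x y u v : ℕ} (hxy : x < y) (huv : u < v) (hy : y < n) (hv : v < n) :
    (segment ℝ (p x) (p y) ∩ segment ℝ (p u) (p v)).Nonempty ↔ Meets x y u v := by
  by_cases h1 : u = x
  · subst h1
    exact iff_of_true ⟨p u, left_mem_segment _ _ _, left_mem_segment _ _ _⟩ (Or.inl rfl)
  by_cases h2 : u = y
  · subst h2
    exact iff_of_true ⟨p u, right_mem_segment _ _ _, left_mem_segment _ _ _⟩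
      (by unfold Meets; tauto)
  by_cases h3 : v = x
  · subst h3
    exact iff_of_true ⟨p v, left_mem_segment _ _ _, right_mem_segment _ _ _⟩
      (by unfold Meets; tauto)
  by_cases h4 : v = y
  · subst h4
    exact iff_of_true ⟨p v, right_mem_segment _ _ _, right_mem_segment _ _ _⟩
      (by unfold Meets; tauto)
  by_cases c1 : x < u ∧ u < y ∧ y < v
  · refine iff_of_true (segment_inter_of_crossing ?_ ?_ ?_ ?_) (by unfold Meets; omega) <;>
      apply hp <;> omega
  by_cases c2 : u < x ∧ x < v ∧ v < y
  · rw [Set.inter_comm]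
    refine iff_of_true (segment_inter_of_crossing ?_ ?_ ?_ ?_) (by unfold Meets; omega) <;>
      apply hp <;> omega
  refine iff_of_false ?_ (by unfold Meets; omega)
  by_cases c3 : y < u
  · exact segment_disjoint_of_orient (hp _ _ _ hxy c3 (by omega)) (hp _ _ _ hxy (by omega) hv)
  by_cases c4 : v < x
  · rw [Set.inter_comm]
    exact segment_disjoint_of_orient (hp _ _ _ huv c4 (by omega)) (hp _ _ _ huv (by omega) hy)
  by_cases c5 : x < u
  · rw [Set.inter_comm]
    refine segment_disjoint_of_orient ?_ (hp _ _ _ huv (by omega) hy)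
    rw [orient_rotate]
    exact hp _ _ _ c5 huv hv
  · refine segment_disjoint_of_orient ?_ (hp _ _ _ hxy (by omega) hv)
    rw [orient_rotate]
    exact hp _ _ _ (by omega) hxy hy

lemma segment_inter_iff_meets {n : ℕ} {p : ℕ → Pt}
    (hp : ∀ i j k, i < j → j < k → k < n → 0 < orient (p i) (p j) (p k))
    {x y u v : ℕ} (hxy : x ≠ y) (huv : u ≠ v) (hx : x < n) (hy : y < n) (hu : u < n) (hv : v < n) :
    (segment ℝ (p x) (p y) ∩ segment ℝ (p u) (p v)).Nonempty ↔ Meets x y u v := by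
  rcases hxy.lt_or_gt with h | h <;> rcases huv.lt_or_gt with h' | h'
  · exact segment_inter_iff_meets_of_lt hp h h' hy hv
  · rw [segment_symm ℝ (p u), segment_inter_iff_meets_of_lt hp h h' hy hu]
    unfold Meets
    omega
  · rw [segment_symm ℝ (p x), segment_inter_iff_meets_of_lt hp h h' hx hv]
    unfold Meets
    omega
  · rw [segment_symm ℝ (p x), segment_symm ℝ (p u), segment_inter_iff_meets_of_lt hp h h' hx hu]
    unfold Meets
    omega

/-- Reduction modulo `n` of a number below `2 * n`. -/
def wrap (n k : ℕ) : ℕ := if k < n then k else k - n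

lemma wrap_cases (n k : ℕ) : (k < n ∧ wrap n k = k) ∨ (n ≤ k ∧ wrap n k + n = k) := by
  unfold wrap
  split_ifs <;> omega

/-- The index `(i, a)` stands for the chord from vertex `i` to the vertex `a` steps further;
every chord of an `n`-gon has exactly one index in this set. -/
def IsIndex (n : ℕ) (x : ℕ × ℕ) : Prop :=
  x.1 < n ∧ 1 ≤ x.2 ∧ (2 * x.2 < n ∨ (2 * x.2 = n ∧ x.1 < x.2))

/-- The chords with indices `x` and `y` intersect. -/
def IdxMeets (n : ℕ) (x y : ℕ × ℕ) : Prop :=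
  Meets x.1 (wrap n (x.1 + x.2)) y.1 (wrap n (y.1 + y.2))

/-- The disjoint chords `x` and `y` are joined by a side of the polygon, and the quadrilateral they
span has a side or a diagonal in the family `H`. -/
def HullPair (n : ℕ) (H : ℕ → ℕ → Prop) (x y : ℕ × ℕ) : Prop :=
  y.1 = wrap n (x.1 + x.2 + 1) ∧ x.2 + y.2 + 2 ≤ n ∧
    (H x.1 x.2 ∨ H y.1 y.2 ∨ H x.1 (x.2 + 1) ∨ H x.1 (x.2 + y.2 + 1) ∨
      H (wrap n (x.1 + x.2)) (y.2 + 1))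

/-- An involution on the chords of an `n`-gon all of whose orbits are single chords of the pairwise
intersecting family `H` or pairs spanning a chord of `H`, with at least `n - 1` fixed chords. -/
structure IsMatching (n : ℕ) (H : ℕ → ℕ → Prop) (σ : ℕ × ℕ → ℕ × ℕ) : Prop where
  le : ∀ i a, H i a → a ≤ n
  meets : ∀ i a j b, i < n → j < n → H i a → H j b → IdxMeets n (i, a) (j, b)
  maps : ∀ x, IsIndex n x → IsIndex n (σ x)
  invol : ∀ x, IsIndex n x → σ (σ x) = x
  pair : ∀ x, IsIndex n x → (σ x = x ∧ H x.1 x.2) ∨ HullPair n H x (σ x) ∨ HullPair n H (σ x) x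
  fixed : ∃ g : ℕ → ℕ × ℕ, (∀ k < n - 1, IsIndex n (g k) ∧ σ (g k) = g k) ∧
    ∀ k < n - 1, ∀ l < n - 1, g k = g l → k = l

lemma HullPair.not_meets {n : ℕ} {H : ℕ → ℕ → Prop} {x y : ℕ × ℕ} (h : HullPair n H x y)
    (hx : IsIndex n x) (hy : IsIndex n y) : ¬IdxMeets n x y := by
  obtain ⟨i, a⟩ := x
  obtain ⟨j, b⟩ := y
  obtain ⟨h1, h2, -⟩ := h
  simp only [IsIndex, IdxMeets, wrap, Meets] at *
  split_ifs at * <;> omega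

/-- A chord meeting a chord between two vertices of a path `z₁z₂z₃z₄` whose middle edge is a side of
the polygon meets one of the other two edges. -/
lemma Meets.of_path {n s t z₁ z₂ z₃ z₄ : ℕ} (hs : s < n) (ht : t < n) (h1 : z₁ < n) (h4 : z₄ < n)
    (h23 : (z₂ + 1 = z₃ ∧ z₃ < n) ∨ (z₂ + 1 = n ∧ z₃ = 0)) {u v : ℕ} (hm : Meets s t u v)
    (hu : u = z₁ ∨ u = z₂ ∨ u = z₃ ∨ u = z₄) (hv : v = z₁ ∨ v = z₂ ∨ v = z₃ ∨ v = z₄)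
    (huv : u ≠ v) : Meets s t z₁ z₂ ∨ Meets s t z₃ z₄ := by
  by_contra hc
  rw [not_or] at hc
  obtain ⟨c1, c2⟩ := hc
  unfold Meets at *
  rcases hu with rfl | rfl | rfl | rfl <;> rcases hv with rfl | rfl | rfl | rfl <;> omega

lemma HullPair.exists_chord {n : ℕ} {H : ℕ → ℕ → Prop} {x y : ℕ × ℕ} (h : HullPair n H x y)
    (hx : IsIndex n x) (hy : IsIndex n y) :
    ∃ i a, i < n ∧ H i a ∧ ∀ s t, s < n → t < n → Meets s t i (wrap n (i + a)) →
      Meets s t x.1 (wrap n (x.1 + x.2)) ∨ Meets s t y.1 (wrap n (y.1 + y.2)) := by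
  obtain ⟨i, a⟩ := x
  obtain ⟨j, b⟩ := y
  obtain ⟨h1, h2, h3⟩ := h
  have key : ∀ u v, (u = i ∨ u = wrap n (i + a) ∨ u = j ∨ u = wrap n (j + b)) →
      (v = i ∨ v = wrap n (i + a) ∨ v = j ∨ v = wrap n (j + b)) → u ≠ v →
      ∀ s t, s < n → t < n → Meets s t u v →
      Meets s t i (wrap n (i + a)) ∨ Meets s t j (wrap n (j + b)) := by
    intro u v hu hv huv s t hs ht hm
    refine Meets.of_path hs ht ?_ ?_ ?_ hm hu hv huv <;>
    · simp only [IsIndex, wrap] at *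
      split_ifs at * <;> omega
  simp only at h1 h2 h3 ⊢
  simp only [IsIndex] at hx hy
  have w₁ := wrap_cases n (i + a)
  have w₂ := wrap_cases n (j + b)
  have w₃ := wrap_cases n (i + a + 1)
  have w₄ := wrap_cases n (i + (a + 1))
  have w₅ := wrap_cases n (i + (a + b + 1))
  have w₆ := wrap_cases n (wrap n (i + a) + (b + 1))
  rcases h3 with h | h | h | h | h
  · exact ⟨_, _, hx.1, h, key _ _ (by omega) (by omega) (by omega)⟩
  · exact ⟨_, _, hy.1, h, key _ _ (by omega) (by omega) (by omega)⟩
  · exact ⟨_, _, hx.1, h, key _ _ (by omega) (by omega) (by omega)⟩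
  · exact ⟨_, _, hx.1, h, key _ _ (by omega) (by omega) (by omega)⟩
  · exact ⟨_, _, by omega, h, key _ _ (by omega) (by omega) (by omega)⟩

lemma Meets.symm {x y u v : ℕ} (h : Meets x y u v) : Meets u v x y := by
  unfold Meets at *
  omega

lemma IsIndex.lt {n : ℕ} {x : ℕ × ℕ} (h : IsIndex n x) :
    x.1 < n ∧ wrap n (x.1 + x.2) < n ∧ x.1 ≠ wrap n (x.1 + x.2) := by
  simp only [IsIndex, wrap] at *
  split_ifs <;> omega

lemma IsMatching.exists_chord {n : ℕ} {H : ℕ → ℕ → Prop} {σ : ℕ × ℕ → ℕ × ℕ}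
    (h : IsMatching n H σ) {x : ℕ × ℕ} (hx : IsIndex n x) :
    ∃ i a, i < n ∧ H i a ∧ ∀ s t, s < n → t < n → Meets s t i (wrap n (i + a)) →
      ∃ x', (x' = x ∨ x' = σ x) ∧ Meets s t x'.1 (wrap n (x'.1 + x'.2)) := by
  rcases h.pair x hx with h1 | h1 | h1
  · exact ⟨x.1, x.2, hx.1, h1.2, fun s t _ _ hm => ⟨x, Or.inl rfl, hm⟩⟩
  · obtain ⟨i, a, hi, hH, hc⟩ := h1.exists_chord hx (h.maps x hx)
    refine ⟨i, a, hi, hH, fun s t hs ht hm => ?_⟩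
    rcases hc s t hs ht hm with h2 | h2
    · exact ⟨x, Or.inl rfl, h2⟩
    · exact ⟨σ x, Or.inr rfl, h2⟩
  · obtain ⟨i, a, hi, hH, hc⟩ := h1.exists_chord (h.maps x hx) hx
    refine ⟨i, a, hi, hH, fun s t hs ht hm => ?_⟩
    rcases hc s t hs ht hm with h2 | h2
    · exact ⟨σ x, Or.inr rfl, h2⟩
    · exact ⟨x, Or.inl rfl, h2⟩

/-- Any two orbits of a matching contain intersecting chords. -/
lemma IsMatching.exists_meets {n : ℕ} {H : ℕ → ℕ → Prop} {σ : ℕ × ℕ → ℕ × ℕ}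
    (h : IsMatching n H σ) {x y : ℕ × ℕ} (hx : IsIndex n x) (hy : IsIndex n y) :
    ∃ x' y', (x' = x ∨ x' = σ x) ∧ (y' = y ∨ y' = σ y) ∧ IdxMeets n x' y' := by
  obtain ⟨i, a, hi, hia, h1⟩ := h.exists_chord hx
  obtain ⟨j, b, hj, hjb, h2⟩ := h.exists_chord hy
  obtain ⟨x', hx', h3⟩ := h1 j (wrap n (j + b)) hj (by
    have := h.le j b hjb
    have := wrap_cases n (j + b)
    omega) (h.meets _ _ _ _ hj hi hjb hia)
  have hx'' : IsIndex n x' := by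
    rcases hx' with rfl | rfl
    · exact hx
    · exact h.maps x hx
  obtain ⟨y', hy', h4⟩ := h2 _ _ hx''.lt.1 hx''.lt.2.1 h3.symm
  exact ⟨x', y', hx', hy', h4⟩

/-- A matching given by its pairs: `R i a b` says that the chord `(i, a)` is paired with the chord of
length `b` that starts one step after the end of `(i, a)`. -/
lemma exists_isMatching_of_rel {n : ℕ} {H : ℕ → ℕ → Prop} (R : ℕ → ℕ → ℕ → Prop)
    (le : ∀ i a, H i a → a ≤ n)
    (meets : ∀ i a j b, i < n → j < n → H i a → H j b → IdxMeets n (i, a) (j, b))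
    (hull : ∀ i a b, IsIndex n (i, a) → IsIndex n (wrap n (i + a + 1), b) → R i a b →
      a + b + 2 ≤ n ∧ (H i a ∨ H (wrap n (i + a + 1)) b ∨ H i (a + 1) ∨ H i (a + b + 1) ∨
        H (wrap n (i + a)) (b + 1)))
    (right_unique : ∀ i a b c, R i a b → R i a c → b = c)
    (left_unique : ∀ i a j b c, IsIndex n (i, a) → IsIndex n (j, b) →
      wrap n (i + a + 1) = wrap n (j + b + 1) → R i a c → R j b c → i = j ∧ a = b)
    (primary : ∀ i a b c, IsIndex n (i, a) → IsIndex n (wrap n (i + a + 1), b) → R i a b →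
      ¬R (wrap n (i + a + 1)) b c)
    (covers : ∀ i a, IsIndex n (i, a) → (∃ b, IsIndex n (wrap n (i + a + 1), b) ∧ R i a b) ∨
      (∃ j b, IsIndex n (j, b) ∧ wrap n (j + b + 1) = i ∧ R j b a) ∨ H i a)
    (fixed : ∃ g : ℕ → ℕ × ℕ, (∀ k < n - 1, IsIndex n (g k) ∧ (∀ b, ¬R (g k).1 (g k).2 b) ∧
        ∀ j b, IsIndex n (j, b) → wrap n (j + b + 1) = (g k).1 → ¬R j b (g k).2) ∧
      ∀ k < n - 1, ∀ l < n - 1, g k = g l → k = l) :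
    ∃ H σ, IsMatching n H σ := by
  let P : ℕ × ℕ → ℕ × ℕ → Prop := fun x y =>
    IsIndex n x ∧ IsIndex n y ∧ y.1 = wrap n (x.1 + x.2 + 1) ∧ R x.1 x.2 y.2
  have hP1 : ∀ x y z, P x y → P x z → y = z := by
    rintro x y z ⟨_, _, h1, h2⟩ ⟨_, _, h3, h4⟩
    exact Prod.ext (h1.trans h3.symm) (right_unique _ _ _ _ h2 h4)
  have hP2 : ∀ x y z, P x z → P y z → x = y := by
    rintro x y z ⟨hx, _, h1, h2⟩ ⟨hy, _, h3, h4⟩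
    have := left_unique _ _ _ _ _ hx hy (h1.symm.trans h3) h2 h4
    exact Prod.ext this.1 this.2
  have hP3 : ∀ x y z, P x y → ¬P y z := by
    rintro x ⟨j, b⟩ z ⟨hx, hy, h1, h2⟩ ⟨_, _, _, h4⟩
    simp only at h1
    subst h1
    exact primary _ _ _ _ hx hy h2 h4
  let σ : ℕ × ℕ → ℕ × ℕ := fun x =>
    if h : ∃ y, P x y then h.choose else if h : ∃ y, P y x then h.choose else x
  have hσ1 : ∀ x y, P x y → σ x = y := by
    intro x y h
    have h' : ∃ y, P x y := ⟨y, h⟩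
    simp only [σ, dif_pos h']
    exact hP1 _ _ _ h'.choose_spec h
  have hσ2 : ∀ x y, P x y → σ y = x := by
    intro x y h
    have h' : ∃ x, P x y := ⟨x, h⟩
    have h'' : ¬∃ z, P y z := fun ⟨z, hz⟩ => hP3 _ _ _ h hz
    simp only [σ, dif_neg h'', dif_pos h']
    exact hP2 _ _ _ h'.choose_spec h
  have hσ3 : ∀ x, (∀ y, ¬P x y) → (∀ y, ¬P y x) → σ x = x := by
    intro x h1 h2
    simp only [σ, dif_neg (not_exists.2 h1), dif_neg (not_exists.2 h2)]
  have hcases : ∀ x, (∃ y, P x y) ∨ (∃ y, P y x) ∨ σ x = x := by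
    intro x
    by_cases h1 : ∃ y, P x y
    · exact Or.inl h1
    by_cases h2 : ∃ y, P y x
    · exact Or.inr (Or.inl h2)
    exact Or.inr (Or.inr (hσ3 x (not_exists.1 h1) (not_exists.1 h2)))
  have hhull : ∀ x y, P x y → HullPair n H x y := by
    rintro ⟨i, a⟩ ⟨j, b⟩ ⟨hx, hy, h1, h2⟩
    simp only at h1
    subst h1
    exact ⟨rfl, hull _ _ _ hx hy h2⟩
  refine ⟨H, σ, le, meets, ?_, ?_, ?_, ?_⟩
  · intro x hx
    rcases hcases x with ⟨y, h⟩ | ⟨y, h⟩ | h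
    · rw [hσ1 _ _ h]
      exact h.2.1
    · rw [hσ2 _ _ h]
      exact h.1
    · rwa [h]
  · intro x hx
    rcases hcases x with ⟨y, h⟩ | ⟨y, h⟩ | h
    · rw [hσ1 _ _ h, hσ2 _ _ h]
    · rw [hσ2 _ _ h, hσ1 _ _ h]
    · rw [h, h]
  · intro x hx
    rcases hcases x with ⟨y, h⟩ | ⟨y, h⟩ | h
    · rw [hσ1 _ _ h]
      exact Or.inr (Or.inl (hhull _ _ h))
    · rw [hσ2 _ _ h]
      exact Or.inr (Or.inr (hhull _ _ h))
    · rcases covers x.1 x.2 hx with ⟨b, hb, hR⟩ | ⟨j, b, hb, hj, hR⟩ | hH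
      · have hxy : P x (_, b) := ⟨hx, hb, rfl, hR⟩
        rw [hσ1 _ _ hxy]
        exact Or.inr (Or.inl (hhull _ _ hxy))
      · have hxy : P (j, b) x := ⟨hb, hx, hj.symm, hR⟩
        rw [hσ2 _ _ hxy]
        exact Or.inr (Or.inr (hhull _ _ hxy))
      · exact Or.inl ⟨h, hH⟩
  · obtain ⟨g, hg, hinj⟩ := fixed
    refine ⟨g, fun k hk => ⟨(hg k hk).1, hσ3 _ ?_ ?_⟩, hinj⟩
    · rintro y ⟨_, _, _, hR⟩
      exact (hg k hk).2.1 _ hR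
    · rintro y ⟨hy, _, hj, hR⟩
      exact (hg k hk).2.2 _ _ hy hj.symm hR

lemma exists_isMatching_four_mul_add_three {r : ℕ} : ∃ H σ, IsMatching (4 * r + 3) H σ := by
  refine exists_isMatching_of_rel (H := fun _ a => a = 2 * r + 1 ∨ a = 2 * r + 2)
    (fun _ a b => a ≤ r ∧ a + b = 2 * r + 1) ?_ ?_ ?_ ?_ ?_ ?_ ?_
    ⟨fun k => (k, 2 * r + 1), ?_, ?_⟩
  · intro i a h
    omega
  · intro i a j b hi hj ha hb
    have := wrap_cases (4 * r + 3) (i + a)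
    have := wrap_cases (4 * r + 3) (j + b)
    simp only [IdxMeets, Meets]
    omega
  · intro i a b _ _ _
    omega
  · intro i a b c h1 h2
    omega
  · intro i a j b c hi hj h h1 h2
    have := wrap_cases (4 * r + 3) (i + a + 1)
    have := wrap_cases (4 * r + 3) (j + b + 1)
    simp only [IsIndex] at hi hj
    omega
  · intro i a b c _ _ h1 h2
    omega
  · intro i a hi
    simp only [IsIndex] at *
    have := wrap_cases (4 * r + 3) (i + a + 1)
    by_cases h1 : a ≤ r
    · exact Or.inl ⟨2 * r + 1 - a, by omega⟩
    by_cases h2 : a = 2 * r + 1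
    · omega
    refine Or.inr (Or.inl ⟨wrap (4 * r + 3) (i + (2 * r + 1 + a)), 2 * r + 1 - a, ?_⟩)
    have := wrap_cases (4 * r + 3) (i + (2 * r + 1 + a))
    have := wrap_cases (4 * r + 3)
      (wrap (4 * r + 3) (i + (2 * r + 1 + a)) + (2 * r + 1 - a) + 1)
    omega
  · intro k hk
    simp only [IsIndex]
    refine ⟨by omega, fun b => by omega, fun j b hj _ => by omega⟩
  · intro k _ l _ h
    simpa using h

lemma exists_isMatching_four_mul_add_one {r : ℕ} (h0 : 0 < r) :
    ∃ H σ, IsMatching (4 * r + 1) H σ := by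
  refine exists_isMatching_of_rel (H := fun _ a => a = 2 * r ∨ a = 2 * r + 1)
    (fun i a b => (a < r ∧ a + b + 1 = 2 * r ∧ a + 1 ≠ 2 * r ∧ 1 ≤ a) ∨
      (a + 1 = 2 * r ∧ i < 2 * r ∧ b = a) ∨
      (a + 1 = 2 * r ∧ i = 4 * r ∧ b = 2 * r)) ?_ ?_ ?_ ?_ ?_ ?_ ?_
    ⟨fun k => (if k < 2 * r - 1 then k else k + 1, 2 * r), ?_, ?_⟩
  · intro i a h
    omega
  · intro i a j b hi hj ha hb
    have := wrap_cases (4 * r + 1) (i + a)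
    have := wrap_cases (4 * r + 1) (j + b)
    simp only [IdxMeets, Meets]
    omega
  · intro i a b _ _ _
    omega
  · intro i a b c h1 h2
    omega
  · intro i a j b c hi hj h h1 h2
    have := wrap_cases (4 * r + 1) (i + a + 1)
    have := wrap_cases (4 * r + 1) (j + b + 1)
    simp only [IsIndex] at hi hj
    omega
  · intro i a b c hi hj h1 h2
    have := wrap_cases (4 * r + 1) (i + a + 1)
    simp only [IsIndex] at hi hj
    omega
  · intro i a hi
    simp only [IsIndex] at *
    have := wrap_cases (4 * r + 1) (i + a + 1)
    by_cases h2 : a = 2 * r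
    · omega
    by_cases h3 : a + 1 = 2 * r
    · by_cases h4 : i < 2 * r
      · exact Or.inl ⟨a, by omega⟩
      by_cases h5 : i = 4 * r
      · exact Or.inl ⟨2 * r, by omega⟩
      refine Or.inr (Or.inl ⟨i - 2 * r, a, ?_⟩)
      have := wrap_cases (4 * r + 1) (i - 2 * r + a + 1)
      omega
    by_cases h1 : a < r
    · exact Or.inl ⟨2 * r - 1 - a, by omega⟩
    refine Or.inr (Or.inl ⟨wrap (4 * r + 1) (i + (2 * r + 1 + a)), 2 * r - 1 - a, ?_⟩)
    have := wrap_cases (4 * r + 1) (i + (2 * r + 1 + a))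
    have := wrap_cases (4 * r + 1)
      (wrap (4 * r + 1) (i + (2 * r + 1 + a)) + (2 * r - 1 - a) + 1)
    omega
  · intro k hk
    simp only [IsIndex]
    refine ⟨by split_ifs <;> omega, fun b => by omega, fun j b hj hw => ?_⟩
    have := wrap_cases (4 * r + 1) (j + b + 1)
    split_ifs at hw <;> omega
  · intro k _ l _ h
    simp only [Prod.mk.injEq] at h
    split_ifs at h <;> omega

lemma exists_isMatching_four_mul_add_two {c : ℕ} (h0 : 0 < c) :
    ∃ H σ, IsMatching (4 * c + 2) H σ := by
  refine exists_isMatching_of_rel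
    (H := fun i a => a = 2 * c + 1 ∨ (a = 2 * c ∧ i < 2 * c + 1))
    (fun i a b => (a = 2 * c ∧ 2 * c + 1 ≤ i ∧ i < 4 * c + 2 ∧ b = c) ∨
      (a = c ∧ i = 3 * c + 1 ∧ b = 2 * c) ∨
      (a = c ∧ 2 * c + 1 ≤ i ∧ i < 3 * c + 1 ∧ b = c) ∨
      (1 ≤ a ∧ a < c ∧ a + b = 2 * c)) ?_ ?_ ?_ ?_ ?_ ?_ ?_
    ⟨fun k => if k < 2 * c + 1 then (k, 2 * c + 1) else (k - 2 * c, 2 * c), ?_, ?_⟩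
  · intro i a h
    omega
  · intro i a j b hi hj ha hb
    have := wrap_cases (4 * c + 2) (i + a)
    have := wrap_cases (4 * c + 2) (j + b)
    simp only [IdxMeets, Meets]
    omega
  · intro i a b hi hj h
    have := wrap_cases (4 * c + 2) (i + a)
    have := wrap_cases (4 * c + 2) (i + a + 1)
    simp only [IsIndex] at hi hj
    omega
  · intro i a b d h1 h2
    omega
  · intro i a j b d hi hj h h1 h2
    have := wrap_cases (4 * c + 2) (i + a + 1)
    have := wrap_cases (4 * c + 2) (j + b + 1)
    simp only [IsIndex] at hi hj
    omega
  · intro i a b d hi hj h1 h2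
    have := wrap_cases (4 * c + 2) (i + a + 1)
    simp only [IsIndex] at hi hj
    omega
  · intro i a hi
    simp only [IsIndex] at *
    have := wrap_cases (4 * c + 2) (i + a + 1)
    by_cases h2 : a = 2 * c + 1
    · omega
    by_cases h3 : a = 2 * c
    · by_cases h4 : i < 2 * c + 1
      · omega
      exact Or.inl ⟨c, by omega⟩
    by_cases h4 : a = c
    · by_cases h5 : i < 2 * c + 1
      · refine Or.inr (Or.inl ⟨i + (2 * c + 1), 2 * c, ?_⟩)
        have := wrap_cases (4 * c + 2) (i + (2 * c + 1) + 2 * c + 1)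
        omega
      by_cases h6 : i = 3 * c + 1
      · exact Or.inl ⟨2 * c, by omega⟩
      by_cases h7 : i < 3 * c + 1
      · exact Or.inl ⟨c, by omega⟩
      refine Or.inr (Or.inl ⟨i - c - 1, c, ?_⟩)
      have := wrap_cases (4 * c + 2) (i - c - 1 + c + 1)
      omega
    by_cases h1 : a < c
    · exact Or.inl ⟨2 * c - a, by omega⟩
    refine Or.inr (Or.inl ⟨wrap (4 * c + 2) (i + (2 * c + 1 + a)), 2 * c - a, ?_⟩)
    have := wrap_cases (4 * c + 2) (i + (2 * c + 1 + a))
    have := wrap_cases (4 * c + 2)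
      (wrap (4 * c + 2) (i + (2 * c + 1 + a)) + (2 * c - a) + 1)
    omega
  · intro k hk
    by_cases h : k < 2 * c + 1
    · simp only [IsIndex, if_pos h]
      exact ⟨by omega, fun b => by omega, fun j b hj hw => by omega⟩
    · simp only [IsIndex, if_neg h]
      refine ⟨by omega, fun b => by omega, fun j b hj hw => ?_⟩
      have := wrap_cases (4 * c + 2) (j + b + 1)
      omega
  · intro k hk l hl h
    dsimp only at h
    split_ifs at h <;> simp only [Prod.mk.injEq] at h <;> omega

/-- A set of residues modulo `4 * q` containing exactly one of `i` and `i + 2 * q`. -/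
def Sel (q i : ℕ) : Prop :=
  i = 0 ∨ i = q ∨ i = q + 1 ∨ (2 * q + 1 ≤ i ∧ i + 1 ≤ 3 * q) ∨ 3 * q + 2 ≤ i

/-- A subset of `Sel q` whose union with its translate by `q` is the translate of `Sel q` by
`q + 1`. -/
def SelSub (q i : ℕ) : Prop := i = 0 ∨ i = q + 1 ∨ i = 2 * q + 2 ∨ 3 * q + 3 ≤ i

lemma exists_isMatching_four_mul {q : ℕ} (h0 : 3 ≤ q) : ∃ H σ, IsMatching (4 * q) H σ := by
  refine exists_isMatching_of_rel
    (H := fun i a => a = 2 * q ∨ (a = 2 * q - 1 ∧ Sel q i))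
    (fun i a b => (a = 2 * q - 1 ∧ ¬Sel q i ∧ b = q) ∨
      (a = q ∧ ¬Sel q i ∧ b = q - 1) ∨
      (a = q - 1 ∧ SelSub q i ∧ b = q - 1) ∨
      (1 ≤ a ∧ a < q - 1 ∧ a + b = 2 * q - 1)) ?_ ?_ ?_ ?_ ?_ ?_ ?_
    ⟨fun k => if k < 2 * q then (k, 2 * q) else
      if Sel q (k - 2 * q) then (k - 2 * q, 2 * q - 1) else (k, 2 * q - 1), ?_, ?_⟩
  · intro i a h
    omega
  · intro i a j b hi hj ha hb
    have := wrap_cases (4 * q) (i + a)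
    have := wrap_cases (4 * q) (j + b)
    have hs : Sel q i → Sel q j → i ≠ j + 2 * q ∧ j ≠ i + 2 * q := by
      unfold Sel
      omega
    simp only [IdxMeets, Meets]
    generalize Sel q i = P at *
    generalize Sel q j = Q at *
    rcases ha with rfl | ⟨rfl, ha⟩ <;> rcases hb with rfl | ⟨rfl, hb⟩
    · clear hs
      omega
    · clear hs
      omega
    · clear hs
      omega
    · specialize hs ha hb
      omega
  · intro i a b hi hj h
    rcases h with h | h | ⟨rfl, h, rfl⟩ | h
    · omega
    · omega
    · have : Sel q i := by
        unfold Sel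
        unfold SelSub at h
        omega
      have : q - 1 + (q - 1) + 1 = 2 * q - 1 := by omega
      rw [this]
      exact ⟨by omega, by tauto⟩
    · omega
  · intro i a b d h1 h2
    omega
  · intro i a j b d hi hj h h1 h2
    have h3 := wrap_cases (4 * q) (i + a + 1)
    have h4 := wrap_cases (4 * q) (j + b + 1)
    rw [← h] at h4
    simp only [IsIndex] at hi hj
    have key : ∀ i j : ℕ, i < 4 * q → j < 4 * q → SelSub q j →
        (i + 1 = j ∨ (j = 0 ∧ i + 1 = 4 * q)) → Sel q i := by
      intro i j _ _
      unfold Sel SelSub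
      omega
    have k1 := key i j hi.1 hj.1
    have k2 := key j i hj.1 hi.1
    clear key h
    rcases h1 with ⟨rfl, h1, rfl⟩ | ⟨rfl, h1, rfl⟩ | ⟨rfl, h1, rfl⟩ | h1 <;>
    rcases h2 with ⟨rfl, h2, h5⟩ | ⟨rfl, h2, h5⟩ | ⟨rfl, h2, h5⟩ | h2
    all_goals try (clear k1 k2; omega)
    · exact absurd (k1 h2 (by omega)) h1
    · exact absurd (k2 h1 (by omega)) h2
  · intro i a b d hi hj h1 h2
    have h3 := wrap_cases (4 * q) (i + a + 1)
    simp only [IsIndex] at hi hj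
    rcases h1 with ⟨rfl, h1, rfl⟩ | ⟨rfl, h1, rfl⟩ | ⟨rfl, h1, rfl⟩ | h1 <;>
    rcases h2 with ⟨h5, h2, rfl⟩ | ⟨h5, h2, rfl⟩ | ⟨h5, h2, rfl⟩ | h2
    all_goals try omega
    all_goals
      simp only [Sel, SelSub] at h1 h2
      omega
  · intro i a hi
    have h := wrap_cases (4 * q) (i + a + 1)
    simp only [IsIndex] at *
    by_cases h2 : a = 2 * q
    · exact Or.inr (Or.inr (Or.inl h2))
    by_cases h3 : a = 2 * q - 1
    · by_cases h4 : Sel q i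
      · exact Or.inr (Or.inr (Or.inr ⟨h3, h4⟩))
      exact Or.inl ⟨q, by omega, Or.inl ⟨h3, h4, rfl⟩⟩
    by_cases h4 : a = q
    · by_cases h5 : Sel q i
      · have h6 := wrap_cases (4 * q) (i + 2 * q)
        have h7 := wrap_cases (4 * q) (wrap (4 * q) (i + 2 * q) + (2 * q - 1) + 1)
        refine Or.inr (Or.inl ⟨wrap (4 * q) (i + 2 * q), 2 * q - 1, by omega, by omega,
          Or.inl ⟨rfl, ?_, h4⟩⟩)
        unfold Sel at *
        omega
      exact Or.inl ⟨q - 1, by omega, Or.inr (Or.inl ⟨h4, h5, rfl⟩)⟩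
    by_cases h6 : a = q - 1
    · by_cases h5 : SelSub q i
      · exact Or.inl ⟨q - 1, by omega, Or.inr (Or.inr (Or.inl ⟨h6, h5, rfl⟩))⟩
      have h8 := wrap_cases (4 * q) (i + 3 * q)
      by_cases h7 : SelSub q (wrap (4 * q) (i + 3 * q))
      · have h9 := wrap_cases (4 * q) (wrap (4 * q) (i + 3 * q) + (q - 1) + 1)
        exact Or.inr (Or.inl ⟨wrap (4 * q) (i + 3 * q), q - 1, by omega, by omega,
          Or.inr (Or.inr (Or.inl ⟨rfl, h7, h6⟩))⟩)
      have h9 := wrap_cases (4 * q) (i + (3 * q - 1))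
      have h10 := wrap_cases (4 * q) (wrap (4 * q) (i + (3 * q - 1)) + q + 1)
      refine Or.inr (Or.inl ⟨wrap (4 * q) (i + (3 * q - 1)), q, by omega, by omega,
        Or.inr (Or.inl ⟨rfl, ?_, h6⟩)⟩)
      clear h h10
      unfold Sel
      unfold SelSub at h5 h7
      omega
    by_cases h1 : a < q - 1
    · exact Or.inl ⟨2 * q - 1 - a, by omega, by omega⟩
    have h7 := wrap_cases (4 * q) (i + (2 * q + a))
    have h8 := wrap_cases (4 * q) (wrap (4 * q) (i + (2 * q + a)) + (2 * q - 1 - a) + 1)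
    exact Or.inr (Or.inl ⟨wrap (4 * q) (i + (2 * q + a)), 2 * q - 1 - a, by omega, by omega,
      by omega⟩)
  · intro k hk
    dsimp only
    split_ifs with h1 h2
    · simp only [IsIndex]
      exact ⟨by omega, fun b => by omega, fun j b hj hw => by omega⟩
    · simp only [IsIndex, Sel] at *
      exact ⟨by omega, fun b => by omega, fun j b hj hw => by omega⟩
    · simp only [IsIndex, Sel] at *
      exact ⟨by omega, fun b => by omega, fun j b hj hw => by omega⟩
  · intro k hk l hl h
    dsimp only at h
    split_ifs at h <;> simp only [Prod.mk.injEq] at h <;> omega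

lemma exists_isMatching_eight : ∃ H σ, IsMatching 8 H σ := by
  let T : List (ℕ × ℕ × ℕ) := [(0, 1, 1), (4, 3, 2), (5, 3, 1), (6, 2, 2), (2, 2, 2), (7, 3, 1),
    (3, 2, 1), (4, 1, 3), (4, 2, 1), (5, 1, 2)]
  refine exists_isMatching_of_rel (H := fun i a => a = 4 ∨ (a = 3 ∧ i < 4))
    (fun i a b => (i, a, b) ∈ T) ?_ ?_ ?_ ?_ ?_ ?_ ?_
    ⟨fun k => if k < 4 then (k, 4) else (k - 4, 3), ?_, ?_⟩
  · intro i a h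
    omega
  · intro i a j b hi hj ha hb
    have := wrap_cases 8 (i + a)
    have := wrap_cases 8 (j + b)
    simp only [IdxMeets, Meets]
    omega
  · intro i a b _ _ h
    have key : ∀ t ∈ T, t.2.1 + t.2.2 + 2 ≤ 8 ∧ (t.2.1 + t.2.2 + 1 = 4 ∨
        (t.2.1 + t.2.2 + 1 = 3 ∧ t.1 < 4) ∨ t.2.1 + 1 = 4 ∨ (t.2.1 + 1 = 3 ∧ t.1 < 4) ∨
        t.2.2 + 1 = 4 ∨ (t.2.2 + 1 = 3 ∧ wrap 8 (t.1 + t.2.1) < 4)) := by decide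
    have := key _ h
    dsimp only at this
    omega
  · intro i a b c h1 h2
    have key : ∀ t ∈ T, ∀ u ∈ T, t.1 = u.1 → t.2.1 = u.2.1 → t.2.2 = u.2.2 := by decide
    exact key _ h1 _ h2 rfl rfl
  · intro i a j b c _ _ h h1 h2
    have key : ∀ t ∈ T, ∀ u ∈ T, wrap 8 (t.1 + t.2.1 + 1) = wrap 8 (u.1 + u.2.1 + 1) →
        t.2.2 = u.2.2 → t.1 = u.1 ∧ t.2.1 = u.2.1 := by decide
    exact key _ h1 _ h2 h rfl
  · intro i a b c _ _ h1 h2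
    have key : ∀ t ∈ T, ∀ u ∈ T, u.1 = wrap 8 (t.1 + t.2.1 + 1) → t.2.2 ≠ u.2.1 := by decide
    exact key _ h1 _ h2 rfl rfl
  · intro i a hi
    simp only [IsIndex] at *
    have index : ∀ t ∈ T, (t.1 < 8 ∧ 1 ≤ t.2.1 ∧ 2 * t.2.1 < 8) ∧
        wrap 8 (t.1 + t.2.1 + 1) < 8 ∧ 1 ≤ t.2.2 ∧ 2 * t.2.2 < 8 := by decide
    have key : ∀ i < 8, ∀ a < 4, a = 0 ∨ (∃ t ∈ T, t.1 = i ∧ t.2.1 = a) ∨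
        (∃ t ∈ T, wrap 8 (t.1 + t.2.1 + 1) = i ∧ t.2.2 = a) ∨ (a = 3 ∧ i < 4) := by decide
    by_cases h4 : a = 4
    · exact Or.inr (Or.inr (Or.inl h4))
    rcases key i hi.1 a (by omega) with h | ⟨⟨i, a, b⟩, ht, rfl, rfl⟩ | ⟨⟨j, b, a⟩, ht, h, rfl⟩ | h
    · omega
    · obtain ⟨-, h5, h6, h7⟩ := index _ ht
      exact Or.inl ⟨b, ⟨h5, h6, Or.inl h7⟩, ht⟩
    · obtain ⟨⟨h5, h6, h7⟩, -⟩ := index _ ht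
      exact Or.inr (Or.inl ⟨j, b, ⟨h5, h6, Or.inl h7⟩, h, ht⟩)
    · exact Or.inr (Or.inr (Or.inr h))
  · intro k hk
    have key : ∀ k < 7, ∀ t ∈ T, t.1 ≠ (if k < 4 then (k, 4) else (k - 4, 3)).1 ∨
        t.2.1 ≠ (if k < 4 then (k, 4) else (k - 4, 3)).2 := by decide
    have key' : ∀ k < 7, ∀ t ∈ T, wrap 8 (t.1 + t.2.1 + 1) = (if k < 4 then (k, 4) else
        (k - 4, 3)).1 → t.2.2 ≠ (if k < 4 then (k, 4) else (k - 4, 3)).2 := by decide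
    refine ⟨?_, fun b h => ?_, fun j b _ hj h => key' k hk _ h hj rfl⟩
    · simp only [IsIndex]
      split_ifs <;> dsimp only <;> omega
    · rcases key k hk _ h with h | h <;> exact h rfl
  · intro k hk l hl h
    dsimp only at h
    split_ifs at h <;> simp only [Prod.mk.injEq] at h <;> omega

lemma exists_isMatching_of_le_two {n : ℕ} (hn : n ≤ 2) : ∃ H σ, IsMatching n H σ := by
  refine ⟨fun _ a => a = 1 ∧ n = 2, id, ?_, ?_, fun x hx => hx, fun _ _ => rfl, ?_,
    fun _ => (0, 1), ?_, ?_⟩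
  · intro i a h
    omega
  · intro i a j b hi hj ha hb
    have := wrap_cases n (i + a)
    have := wrap_cases n (j + b)
    simp only [IdxMeets, Meets]
    omega
  · intro x hx
    simp only [IsIndex] at hx
    exact Or.inl ⟨rfl, by omega⟩
  · intro k hk
    refine ⟨?_, rfl⟩
    simp only [IsIndex]
    omega
  · intro k _ l _ _
    omega

lemma exists_isMatching {n : ℕ} (h4 : n ≠ 4) : ∃ H σ, IsMatching n H σ := by
  by_cases h2 : n ≤ 2
  · exact exists_isMatching_of_le_two h2
  by_cases h8 : n = 8
  · subst h8
    exact exists_isMatching_eight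
  obtain ⟨r, h | h | h | h⟩ : ∃ r, n = 4 * r ∨ n = 4 * r + 1 ∨ n = 4 * r + 2 ∨ n = 4 * r + 3 :=
    ⟨n / 4, by omega⟩
  all_goals subst h
  · exact exists_isMatching_four_mul (by omega)
  · exact exists_isMatching_four_mul_add_one (by omega)
  · exact exists_isMatching_four_mul_add_two (by omega)
  · exact exists_isMatching_four_mul_add_three

/-- The edge with index `x` in the convex polygon with vertices `p 0, …, p (n - 1)`. -/
noncomputable def polyEdge (n : ℕ) (p : ℕ → Pt) (x : ℕ × ℕ) : Sym2 Pt :=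
  s(p x.1, p (wrap n (x.1 + x.2)))

lemma sInter_polyEdge_iff {n : ℕ} {p : ℕ → Pt}
    (hp : ∀ i j k, i < j → j < k → k < n → 0 < orient (p i) (p j) (p k)) {x y : ℕ × ℕ}
    (hx : IsIndex n x) (hy : IsIndex n y) :
    SInter (polyEdge n p x) (polyEdge n p y) ↔ IdxMeets n x y :=
  segment_inter_iff_meets hp hx.lt.2.2 hy.lt.2.2 hx.lt.1 hx.lt.2.1 hy.lt.1 hy.lt.2.1

lemma polyEdge_inj {n : ℕ} {p : ℕ → Pt} (hinj : ∀ i < n, ∀ j < n, p i = p j → i = j)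
    {x y : ℕ × ℕ} (hx : IsIndex n x) (hy : IsIndex n y) (h : polyEdge n p x = polyEdge n p y) :
    x = y := by
  obtain ⟨i, a⟩ := x
  obtain ⟨j, b⟩ := y
  obtain ⟨hx1, hx2, -⟩ := hx.lt
  obtain ⟨hy1, hy2, -⟩ := hy.lt
  have h1 := wrap_cases n (i + a)
  have h2 := wrap_cases n (j + b)
  simp only [polyEdge, Sym2.eq_iff] at h
  simp only [IsIndex] at *
  rw [Prod.mk.injEq]
  rcases h with ⟨h3, h4⟩ | ⟨h3, h4⟩
  · have := hinj _ hx1 _ hy1 h3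
    have := hinj _ hx2 _ hy2 h4
    omega
  · have := hinj _ hx1 _ hy2 h3
    have := hinj _ hx2 _ hy1 h4
    omega

lemma mem_edgeSet_iff {S : Finset Pt} {p : ℕ → Pt}
    (hp : ∀ x, x ∈ S ↔ ∃ i < S.card, p i = x)
    (hinj : ∀ i < S.card, ∀ j < S.card, p i = p j → i = j) {e : Sym2 Pt} :
    e ∈ edgeSet S ↔ ∃ x, IsIndex S.card x ∧ polyEdge S.card p x = e := by
  constructor
  · have key : ∀ u v, u < v → v < S.card →
        ∃ x, IsIndex S.card x ∧ polyEdge S.card p x = s(p u, p v) := by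
      intro u v huv hv
      simp only [IsIndex, polyEdge]
      by_cases h : 2 * (v - u) < S.card ∨ (2 * (v - u) = S.card ∧ u < v - u)
      · refine ⟨(u, v - u), by omega, ?_⟩
        have := wrap_cases S.card (u + (v - u))
        have h1 : wrap S.card (u + (v - u)) = v := by omega
        simp only [h1]
      · refine ⟨(v, S.card - (v - u)), by omega, ?_⟩
        have := wrap_cases S.card (v + (S.card - (v - u)))
        have h1 : wrap S.card (v + (S.card - (v - u))) = u := by omega
        simp only [h1, Sym2.eq_swap]
    induction e with
    | _ a b =>
      intro h
      simp only [edgeSet, Finset.mem_filter, Finset.mk_mem_sym2_iff, Sym2.mk_isDiag_iff] at h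
      obtain ⟨⟨ha, hb⟩, hab⟩ := h
      obtain ⟨u, hu, rfl⟩ := (hp a).1 ha
      obtain ⟨v, hv, rfl⟩ := (hp b).1 hb
      have huv : u ≠ v := fun h => hab (congrArg p h)
      rcases huv.lt_or_gt with h | h
      · exact key u v h hv
      · rw [Sym2.eq_swap]
        exact key v u h hu
  · rintro ⟨x, hx, rfl⟩
    obtain ⟨h1, h2, h3⟩ := hx.lt
    simp only [edgeSet, polyEdge, Finset.mem_filter, Finset.mk_mem_sym2_iff, Sym2.mk_isDiag_iff]
    exact ⟨⟨(hp _).2 ⟨_, h1, rfl⟩, (hp _).2 ⟨_, h2, rfl⟩⟩, fun h => h3 (hinj _ h1 _ h2 h)⟩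

lemma card_edgeSet (S : Finset Pt) : (edgeSet S).card = S.card.choose 2 := by
  rw [← Sym2.card_image_offDiag, ← Sym2.filter_image_mk_not_isDiag, ← Finset.sym2_eq_image,
    edgeSet]

/-- The values taken exactly once by `c` on `E`. -/
noncomputable def uniqueValues {α : Type*} (E : Finset α) (c : α → ℕ) : Finset ℕ :=
  (E.image c).filter fun i => (E.filter fun e => c e = i).card = 1

lemma two_mul_card_image_le {α : Type*} (E : Finset α) (c : α → ℕ) :
    2 * (E.image c).card ≤ E.card + (uniqueValues E c).card := by
  rw [Finset.card_eq_sum_card_image c E, uniqueValues, Finset.card_filter,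
    ← Finset.sum_add_distrib, mul_comm, ← smul_eq_mul, ← Finset.sum_const]
  refine Finset.sum_le_sum fun i hi => ?_
  obtain ⟨e, he, rfl⟩ := Finset.mem_image.1 hi
  have : 0 < (E.filter fun f => c f = c e).card :=
    Finset.card_pos.2 ⟨e, Finset.mem_filter.2 ⟨he, rfl⟩⟩
  split_ifs <;> omega

lemma le_two_mul_card_image {α : Type*} (E : Finset α) (c : α → ℕ)
    (h : ∀ e ∈ E, (E.filter fun f => c f = c e).card ≤ 2) :
    E.card + (uniqueValues E c).card ≤ 2 * (E.image c).card := by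
  rw [Finset.card_eq_sum_card_image c E, uniqueValues, Finset.card_filter,
    ← Finset.sum_add_distrib, mul_comm 2, ← smul_eq_mul, ← Finset.sum_const]
  refine Finset.sum_le_sum fun i hi => ?_
  obtain ⟨e, he, rfl⟩ := Finset.mem_image.1 hi
  have := h e he
  split_ifs <;> omega

/-- The sum modulo `n` of the endpoints distinguishes intersecting chords. -/
lemma IdxMeets.sum_ne {n : ℕ} {x y : ℕ × ℕ} (h : IdxMeets n x y) (hx : IsIndex n x)
    (hy : IsIndex n y) (hxy : x ≠ y) :
    wrap n (x.1 + wrap n (x.1 + x.2)) ≠ wrap n (y.1 + wrap n (y.1 + y.2)) := by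
  obtain ⟨i, a⟩ := x
  obtain ⟨j, b⟩ := y
  have h1 := wrap_cases n (i + a)
  have h2 := wrap_cases n (j + b)
  obtain ⟨hx1, hx2, hx3⟩ := hx.lt
  obtain ⟨hy1, hy2, hy3⟩ := hy.lt
  have hne : ¬(i = j ∧ a = b) := fun h => hxy (Prod.ext h.1 h.2)
  simp only [IsIndex, IdxMeets] at *
  have h3 : ¬((i = j ∧ wrap n (i + a) = wrap n (j + b)) ∨
      (i = wrap n (j + b) ∧ wrap n (i + a) = j)) := by omega
  clear hne hxy h1 h2 hx hy
  generalize wrap n (i + a) = u at *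
  generalize wrap n (j + b) = v at *
  have h4 := wrap_cases n (i + u)
  have h5 := wrap_cases n (j + v)
  unfold Meets at h
  omega

lemma CompleteOn.card_image_le {S : Finset Pt} (hgp : GenPos S) (hconv : ConvexPos S)
    {c : Sym2 Pt → ℕ} (hc : CompleteOn (edgeSet S) c) :
    2 * ((edgeSet S).image c).card ≤ S.card.choose 2 + S.card := by
  obtain ⟨p, hp, hinj, horient⟩ := exists_ccw_enum hgp hconv
  refine (two_mul_card_image_le _ c).trans ?_
  rw [card_edgeSet]
  refine Nat.add_le_add_left ?_ _
  have hidx : ∀ i ∈ uniqueValues (edgeSet S) c, ∃ x, IsIndex S.card x ∧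
      ∀ e ∈ edgeSet S, c e = i → e = polyEdge S.card p x := by
    intro i hi
    obtain ⟨e, he⟩ := Finset.card_eq_one.1 (Finset.mem_filter.1 hi).2
    have he' : e ∈ (edgeSet S).filter fun f => c f = i := he ▸ Finset.mem_singleton_self e
    obtain ⟨x, hx, rfl⟩ := (mem_edgeSet_iff hp hinj).1 (Finset.mem_filter.1 he').1
    refine ⟨x, hx, fun f hf hfi => Finset.mem_singleton.1 ?_⟩
    rw [← he]
    exact Finset.mem_filter.2 ⟨hf, hfi⟩
  choose! g hg hg' using hidx
  have hcard : (Finset.range S.card).card = S.card := Finset.card_range _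
  rw [← hcard]
  refine Finset.card_le_card_of_injOn
    (fun i => wrap S.card ((g i).1 + wrap S.card ((g i).1 + (g i).2))) ?_ ?_
  · intro i hi
    obtain ⟨h1, h2, -⟩ := (hg i hi).lt
    have := wrap_cases S.card ((g i).1 + wrap S.card ((g i).1 + (g i).2))
    simp only [Finset.coe_range, Set.mem_Iio]
    omega
  · intro i hi j hj hij
    by_contra hne
    obtain ⟨e, he, f, hf, hei, hfj, hef⟩ :=
      hc i (Finset.mem_filter.1 hi).1 j (Finset.mem_filter.1 hj).1 hne
    have hxy : g i ≠ g j := by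
      intro h
      have h1 := hg' i hi e he hei
      rw [h, ← hg' j hj f hf hfj] at h1
      rw [h1] at hei
      exact hne (hei.symm.trans hfj)
    rw [hg' i hi e he hei, hg' j hj f hf hfj,
      sInter_polyEdge_iff horient (hg i hi) (hg j hj)] at hef
    exact hef.sum_ne (hg i hi) (hg j hj) hxy hij

lemma exists_proper_complete {S : Finset Pt} (hgp : GenPos S) (hconv : ConvexPos S)
    (h4 : S.card ≠ 4) : ∃ c : Sym2 Pt → ℕ, ProperOn (edgeSet S) c ∧ CompleteOn (edgeSet S) c ∧
      S.card.choose 2 + (S.card - 1) ≤ 2 * ((edgeSet S).image c).card := by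
  obtain ⟨p, hp, hinj, horient⟩ := exists_ccw_enum hgp hconv
  obtain ⟨H, σ, hσ⟩ := exists_isMatching h4
  let index : Sym2 Pt → ℕ × ℕ := Function.invFunOn (polyEdge S.card p) {x | IsIndex S.card x}
  have hindex : ∀ x, IsIndex S.card x → index (polyEdge S.card p x) = x := fun x hx =>
    Set.InjOn.leftInvOn_invFunOn (fun x hx y hy h => polyEdge_inj hinj hx hy h) hx
  let code : ℕ × ℕ → ℕ := fun x => min (Nat.pairEquiv x) (Nat.pairEquiv (σ x))
  have hcode : ∀ x y, IsIndex S.card x → IsIndex S.card y →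
      (code x = code y ↔ y = x ∨ y = σ x) := by
    intro x y hx hy
    constructor
    · intro h
      have key : ∀ u v, Nat.pairEquiv u = Nat.pairEquiv v → u = v :=
        fun u v h => Nat.pairEquiv.injective h
      simp only [code] at h
      rcases min_choice (Nat.pairEquiv x) (Nat.pairEquiv (σ x)) with h1 | h1 <;>
      rcases min_choice (Nat.pairEquiv y) (Nat.pairEquiv (σ y)) with h2 | h2 <;>
      rw [h1, h2] at h <;> have h3 := key _ _ h
      · exact Or.inl h3.symm
      · right
        rw [h3, hσ.invol y hy]
      · exact Or.inr h3.symm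
      · left
        rw [← hσ.invol y hy, ← h3, hσ.invol x hx]
    · rintro (rfl | rfl)
      · rfl
      · simp only [code, hσ.invol x hx, min_comm]
  let c : Sym2 Pt → ℕ := fun e => code (index e)
  have hc : ∀ x y, IsIndex S.card x → IsIndex S.card y →
      (c (polyEdge S.card p x) = c (polyEdge S.card p y) ↔ y = x ∨ y = σ x) := by
    intro x y hx hy
    simp only [c, hindex x hx, hindex y hy, hcode x y hx hy]
  have hE : ∀ e, e ∈ edgeSet S ↔ ∃ x, IsIndex S.card x ∧ polyEdge S.card p x = e :=
    fun e => mem_edgeSet_iff hp hinj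
  refine ⟨c, ?_, ?_, ?_⟩
  · intro e he f hf hef hcef
    obtain ⟨x, hx, rfl⟩ := (hE e).1 he
    obtain ⟨y, hy, rfl⟩ := (hE f).1 hf
    rw [sInter_polyEdge_iff horient hx hy]
    rcases (hc x y hx hy).1 hcef with rfl | rfl
    · exact absurd rfl hef
    rcases hσ.pair x hx with ⟨h, -⟩ | h | h
    · rw [h] at hef
      exact absurd rfl hef
    · exact h.not_meets hx hy
    · exact fun h' => h.not_meets hy hx h'.symm
  · intro i hi j hj _
    obtain ⟨e, he, rfl⟩ := Finset.mem_image.1 hi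
    obtain ⟨f, hf, rfl⟩ := Finset.mem_image.1 hj
    obtain ⟨x, hx, rfl⟩ := (hE e).1 he
    obtain ⟨y, hy, rfl⟩ := (hE f).1 hf
    obtain ⟨x', y', hxx', hyy', h⟩ := hσ.exists_meets hx hy
    have hx' : IsIndex S.card x' := by
      rcases hxx' with rfl | rfl
      exacts [hx, hσ.maps x hx]
    have hy' : IsIndex S.card y' := by
      rcases hyy' with rfl | rfl
      exacts [hy, hσ.maps y hy]
    exact ⟨_, (hE _).2 ⟨x', hx', rfl⟩, _, (hE _).2 ⟨y', hy', rfl⟩, ((hc x x' hx hx').2 hxx').symm,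
      ((hc y y' hy hy').2 hyy').symm, (sInter_polyEdge_iff horient hx' hy').2 h⟩
  · have hfibre : ∀ x, IsIndex S.card x →
        ((edgeSet S).filter fun f => c f = c (polyEdge S.card p x)) ⊆
          {polyEdge S.card p x, polyEdge S.card p (σ x)} := by
      intro x hx f hf
      obtain ⟨hf, hfx⟩ := Finset.mem_filter.1 hf
      obtain ⟨y, hy, rfl⟩ := (hE f).1 hf
      rcases (hc x y hx hy).1 hfx.symm with rfl | rfl <;> simp
    refine le_trans ?_ (le_two_mul_card_image (edgeSet S) c ?_)
    · rw [card_edgeSet]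
      refine Nat.add_le_add_left ?_ _
      obtain ⟨g, hg, hginj⟩ := hσ.fixed
      have hcard : (Finset.range (S.card - 1)).card = S.card - 1 := Finset.card_range _
      rw [← hcard]
      refine Finset.card_le_card_of_injOn (fun k => c (polyEdge S.card p (g k))) ?_ ?_
      · intro k hk
        obtain ⟨h1, h2⟩ := hg k (Finset.mem_range.1 hk)
        have hmem := (hE _).2 ⟨g k, h1, rfl⟩
        refine Finset.mem_filter.2 ⟨Finset.mem_image_of_mem c hmem,
          Finset.card_eq_one.2 ⟨polyEdge S.card p (g k), Finset.Subset.antisymm ?_ ?_⟩⟩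
        · have := hfibre _ h1
          rwa [h2, Finset.pair_eq_singleton] at this
        · exact Finset.singleton_subset_iff.2 (Finset.mem_filter.2 ⟨hmem, rfl⟩)
      · intro k hk l hl hkl
        have hk := Finset.mem_range.1 hk
        have hl := Finset.mem_range.1 hl
        obtain ⟨h1, h2⟩ := hg k hk
        obtain ⟨h3, -⟩ := hg l hl
        have h := (hc _ _ h1 h3).1 hkl
        rw [h2, or_self] at h
        exact hginj k hk l hl h.symm
    · intro e he
      obtain ⟨x, hx, rfl⟩ := (hE e).1 he
      exact (Finset.card_le_card (hfibre x hx)).trans Finset.card_le_two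

/-- For `n ≠ 4`, the achromatic and pseudoachromatic indices of the complete convex
geometric graph on `n` vertices both equal `⌊(n² + n)/4⌋`: there is a proper complete
coloring with exactly that many colors, and no complete coloring uses more. -/
theorem achromatic_eq_pseudoachromatic (S : Finset Pt) (n : ℕ) (hn : S.card = n)
    (h4 : n ≠ 4) (hgp : GenPos S) (hconv : ConvexPos S) :
    (∃ c : Sym2 Pt → ℕ, ProperOn (edgeSet S) c ∧ CompleteOn (edgeSet S) c ∧
      ((edgeSet S).image c).card = (n ^ 2 + n) / 4) ∧
    (∀ c : Sym2 Pt → ℕ, CompleteOn (edgeSet S) c →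
      ((edgeSet S).image c).card ≤ (n ^ 2 + n) / 4) := by
  subst hn
  have hchoose : S.card ^ 2 = 2 * S.card.choose 2 + S.card := by
    rw [Nat.choose_two_right, Nat.mul_div_cancel' (Nat.even_mul_pred_self _).two_dvd]
    cases S.card
    · rfl
    · simp only [Nat.add_sub_cancel]
      ring
  have upper : ∀ c : Sym2 Pt → ℕ, CompleteOn (edgeSet S) c →
      ((edgeSet S).image c).card ≤ (S.card ^ 2 + S.card) / 4 := by
    intro c hc
    have := hc.card_image_le hgp hconv
    omega
  obtain ⟨c, h1, h2, h3⟩ := exists_proper_complete hgp hconv h4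
  refine ⟨⟨c, h1, h2, ?_⟩, upper⟩
  have := upper c h2
  omega
end
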